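/- arXiv:2408.16385 — 4 statements merged into one kernel-verified Lean document; each statement's English description precedes it below -/
import Mathlib

section
/- Let δ : [0,∞) → [0,1) be measurable, admit a unique flow, and be constant (equal to some γ ∈ [0,1)) on an interval [0,ε] with ε > 0. Then for every càdlàg path X with no positive jumps and every real x̄ ≥ max(X_0, 0) there exists a tax-reflection pair (V⁺, K⁺) for (X, δ, x̄). (Existence part of Theorem 2.2.) -/
open MeasureTheory Set Filter Function

noncomputable section

/-- Running supremum of a path over `[0, t]`. -/
def runSSup (Z : ℝ → ℝ) (t : ℝ) : ℝ := sSup (Z '' Set.Icc 0 t)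

/-- Running supremum of a path with initial maximum level `xbar`. -/
def runSup (xbar : ℝ) (Z : ℝ → ℝ) (t : ℝ) : ℝ := max xbar (runSSup Z t)

/-- Skorokhod regulator at 0. -/
def Psi (Y : ℝ → ℝ) (t : ℝ) : ℝ := max 0 (-(sInf (Y '' Set.Icc 0 t)))

/-- Reflection of a path at 0 from below. -/
def Phi (Y : ℝ → ℝ) (t : ℝ) : ℝ := Y t + Psi Y t

/-- A path, viewed on `[0,∞)`, is càdlàg: right-continuous at every `t ≥ 0` and
with left limits at every `t > 0`. -/
def Cadlag (Z : ℝ → ℝ) : Prop :=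
  (∀ t : ℝ, 0 ≤ t → ContinuousWithinAt Z (Set.Ici t) t) ∧
  (∀ t : ℝ, 0 < t → ∃ l : ℝ, Filter.Tendsto Z (nhdsWithin t (Set.Iio t)) (nhds l))

/-- A càdlàg path has no positive jumps if `ΔZ_t = Z_t - Z_{t-} ≤ 0` for all `t > 0`. -/
def NoPosJumps (Z : ℝ → ℝ) : Prop :=
  ∀ t : ℝ, 0 < t → Z t ≤ Function.leftLim Z t

/-- Lebesgue–Stieltjes measure of an increasing right-continuous path on `[0,∞)`,
without the atom at `0`. -/
def lsMeasureAux (f : ℝ → ℝ) : Measure ℝ := by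
  classical
  exact if h : Monotone (fun t => f (max t 0)) ∧
      ∀ x : ℝ, ContinuousWithinAt (fun t => f (max t 0)) (Set.Ici x) x then
    StieltjesFunction.measure ⟨fun t => f (max t 0), h.1, h.2⟩
  else 0

/-- Lebesgue–Stieltjes measure of an increasing right-continuous path on `[0,∞)`,
with an atom of mass `f 0` at `0`. -/
def lsMeasure (f : ℝ → ℝ) : Measure ℝ :=
  lsMeasureAux f + (ENNReal.ofReal (f 0)) • Measure.dirac 0

/-- `(V, K)` is a tax-reflection pair for `(X, δ, xbar)`. -/
def IsTaxReflectionPair (δ : ℝ → ℝ) (X : ℝ → ℝ) (xbar : ℝ) (V K : ℝ → ℝ) : Prop :=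
  Cadlag V ∧ Cadlag K ∧
  (∀ t : ℝ, 0 ≤ t → 0 ≤ V t) ∧
  MonotoneOn K (Set.Ici 0) ∧
  (∀ t : ℝ, 0 ≤ t →
    V t = X t + K t -
      ∫ s in Set.Ioc (0:ℝ) t, δ (V s)
        ∂(lsMeasure (runSup xbar (fun s => X s + K s)))) ∧
  lsMeasure K {t : ℝ | 0 ≤ t ∧ 0 < V t} = 0

/-- A solution of the ODE `y' = 1 - δ(y)`, `y(0) = y₀`, on `[0,∞)`. -/
def IsFlow (δ : ℝ → ℝ) (y₀ : ℝ) (y : ℝ → ℝ) : Prop :=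
  ContinuousOn y (Set.Ici 0) ∧
  ∀ t : ℝ, 0 ≤ t → y t = y₀ + ∫ s in (0:ℝ)..t, (1 - δ (y s))

/-- `δ` admits a unique flow: for every `y₀ ≥ 0` the ODE `y' = 1 - δ(y)`, `y(0) = y₀`
has exactly one continuous solution on `[0,∞)`. -/
def AdmitsUniqueFlow (δ : ℝ → ℝ) : Prop :=
  ∀ y₀ : ℝ, 0 ≤ y₀ →
    (∃ y : ℝ → ℝ, IsFlow δ y₀ y) ∧
    ∀ y z : ℝ → ℝ, IsFlow δ y₀ y → IsFlow δ y₀ z → ∀ t : ℝ, 0 ≤ t → y t = z t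

/-- A flow started from a positive level never falls below that level. -/
lemma IsFlow.le_of_pos {δ : ℝ → ℝ} (hδ : ∀ y, 0 ≤ y → δ y ∈ Ico (0 : ℝ) 1) {y₀ : ℝ}
    (hy₀ : 0 < y₀) {y : ℝ → ℝ} (hy : IsFlow δ y₀ y) {t : ℝ} (ht : 0 ≤ t) : y₀ ≤ y t := by
  have key : ∀ r, 0 ≤ r → (∀ s ∈ Icc 0 r, 0 ≤ y s) → y₀ ≤ y r := by
    intro r hr h
    rw [hy.2 r hr]
    have : 0 ≤ ∫ s in (0:ℝ)..r, (1 - δ (y s)) :=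
      intervalIntegral.integral_nonneg hr fun s hs => by linarith [(hδ _ (h s hs)).2]
    linarith
  refine key t ht fun s hs => ?_
  by_contra! hneg
  have hcont : ContinuousOn y (Icc 0 s) := hy.1.mono Icc_subset_Ici_self
  have hcpt : IsCompact (Icc 0 s ∩ y ⁻¹' Iic 0) :=
    isCompact_Icc.of_isClosed_subset (hcont.preimage_isClosed_of_isClosed isClosed_Icc isClosed_Iic)
      inter_subset_left
  obtain ⟨σ, ⟨hσ, hσy⟩, hleast⟩ := hcpt.exists_isLeast ⟨s, ⟨hs.1, le_rfl⟩, hneg.le⟩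
  have hlt : ∀ r ∈ Ico 0 σ, 0 ≤ y r := fun r hr => by
    by_contra! hr'
    exact absurd (hleast ⟨⟨hr.1, hr.2.le.trans hσ.2⟩, hr'.le⟩) (not_le.2 hr.2)
  have hσ0 : 0 < σ := by
    rcases hσ.1.eq_or_lt with h | h
    · have := hy.2 0 le_rfl
      rw [← h] at hσy
      simp at this hσy
      linarith
    · exact h
  have hσ' : 0 ≤ y σ := by
    have hc : ContinuousWithinAt y (Iio σ) σ :=
      (hcont.continuousWithinAt hσ).mono_of_mem_nhdsWithin <| by
        filter_upwards [Ioo_mem_nhdsLT hσ0] with r hr using ⟨hr.1.le, hr.2.le.trans hσ.2⟩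
    refine ge_of_tendsto hc ?_
    filter_upwards [Ioo_mem_nhdsLT hσ0] with r hr using hlt r ⟨hr.1.le, hr.2⟩
  have := key σ hσ.1 fun r hr => (hr.2.eq_or_lt).elim (fun h => h ▸ hσ')
    fun h => hlt r ⟨hr.1, h⟩
  have h2 : y σ ≤ 0 := hσy
  linarith

lemma intervalIntegrable_comp_of_nonneg {δ : ℝ → ℝ} (hδm : Measurable δ)
    (hδ : ∀ y, 0 ≤ y → δ y ∈ Ico (0 : ℝ) 1) {y : ℝ → ℝ} (hym : Measurable y) (hy0 : ∀ t, 0 ≤ y t)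
    (a b : ℝ) : IntervalIntegrable (fun s => δ (y s)) volume a b := by
  refine (intervalIntegrable_const (c := (1 : ℝ))).mono_fun
    (hδm.comp hym).aestronglyMeasurable (Eventually.of_forall fun s => ?_)
  have := hδ _ (hy0 s)
  simp only [Real.norm_eq_abs, abs_one]
  rw [abs_of_nonneg this.1]
  exact this.2.le

/-- Global version of a nonnegative flow, extended by its initial value to `(-∞, 0)`. -/
lemma exists_extended_flow {δ : ℝ → ℝ} (hδm : Measurable δ)
    (hδ : ∀ y, 0 ≤ y → δ y ∈ Ico (0 : ℝ) 1) {y₀ : ℝ} {z : ℝ → ℝ} (hz : IsFlow δ y₀ z)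
    (hz0 : ∀ t, 0 ≤ t → 0 ≤ z t) :
    ∃ y : ℝ → ℝ, Continuous y ∧ Monotone y ∧ (∀ a b, a ≤ b → y b - y a ≤ b - a) ∧
      y 0 = y₀ ∧ (∀ r, 0 < r → y₀ < y r) ∧
      ∀ r, 0 ≤ r → ∫ s in (0:ℝ)..r, δ (y s) = r + y₀ - y r := by
  set y : ℝ → ℝ := fun t => z (max t 0) with hydef
  have hyz : ∀ t, 0 ≤ t → y t = z t := fun t ht => by simp [hydef, ht]
  have hyc : Continuous y := hz.1.comp_continuous (by fun_prop) fun x => mem_Ici.2 (le_max_right _ _)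
  have hy0 : ∀ t, 0 ≤ y t := fun t => hz0 _ (le_max_right _ _)
  have hint := fun a b => intervalIntegrable_comp_of_nonneg hδm hδ hyc.measurable hy0 a b
  have hint1 : ∀ a b, IntervalIntegrable (fun s => 1 - δ (y s)) volume a b := fun a b =>
    intervalIntegrable_const.sub (hint a b)
  have heq : ∀ t, 0 ≤ t → y t = y₀ + ∫ s in (0:ℝ)..t, (1 - δ (y s)) := fun t ht => by
    rw [hyz t ht, hz.2 t ht]
    congr 1
    refine intervalIntegral.integral_congr fun s hs => ?_
    rw [uIcc_of_le ht] at hs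
    simp only [hyz s hs.1]
  have hinc : ∀ a b, 0 ≤ a → a ≤ b → y b - y a = ∫ s in a..b, (1 - δ (y s)) := by
    intro a b ha hab
    rw [heq a ha, heq b (ha.trans hab),
      ← intervalIntegral.integral_add_adjacent_intervals (hint1 0 a) (hint1 a b)]
    ring
  have hmax : ∀ t, y t = y (max t 0) := fun t => by simp [hydef]
  have hy00 : y 0 = y₀ := by simpa using heq 0 le_rfl
  refine ⟨y, hyc, ?_, ?_, hy00, ?_, ?_⟩
  · intro a b hab
    rw [hmax a, hmax b, ← sub_nonneg,
      hinc _ _ (le_max_right _ _) (max_le_max_right 0 hab)]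
    exact intervalIntegral.integral_nonneg (max_le_max_right 0 hab)
      fun s _ => by linarith [(hδ _ (hy0 s)).2]
  · intro a b hab
    have hab' : max a 0 ≤ max b 0 := max_le_max_right 0 hab
    rw [hmax a, hmax b, hinc _ _ (le_max_right _ _) hab']
    have h1 : ∫ s in (max a 0)..(max b 0), (1 - δ (y s)) ≤ ∫ s in (max a 0)..(max b 0), (1:ℝ) :=
      intervalIntegral.integral_mono_on hab' (hint1 _ _) intervalIntegrable_const
        fun s _ => by linarith [(hδ _ (hy0 s)).1]
    rw [intervalIntegral.integral_const, smul_eq_mul, mul_one] at h1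
    refine h1.trans ?_
    rcases le_total a 0 with h | h <;> rcases le_total b 0 with h' | h' <;> simp [h, h'] <;> linarith
  · intro r hr
    rw [heq r hr.le]
    have := intervalIntegral.intervalIntegral_pos_of_pos_on (hint1 0 r)
      (fun s _ => by linarith [(hδ _ (hy0 s)).2]) hr
    linarith
  · intro r hr
    have h1 := heq r hr
    rw [intervalIntegral.integral_sub intervalIntegrable_const (hint 0 r),
      intervalIntegral.integral_const, smul_eq_mul] at h1
    linarith

/-- A flow from `0` staying nonnegative, when `δ` is constant near `0`. -/
lemma exists_isFlow_zero {δ : ℝ → ℝ} (hδm : Measurable δ)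
    (hδ : ∀ y, 0 ≤ y → δ y ∈ Ico (0 : ℝ) 1)
    (hflow : AdmitsUniqueFlow δ) {γ ε : ℝ} (hγ : γ ∈ Ico (0 : ℝ) 1) (hε : 0 < ε)
    (hconst : ∀ y ∈ Icc (0:ℝ) ε, δ y = γ) :
    ∃ y, IsFlow δ 0 y ∧ ∀ t, 0 ≤ t → 0 ≤ y t := by
  obtain ⟨w, hw⟩ := (hflow ε hε.le).1
  obtain ⟨y, hyc, hymono, -, hy00, -, hyint⟩ := exists_extended_flow hδm hδ hw
    fun t ht => hε.le.trans (hw.le_of_pos hδ hε ht)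
  have hγ' : 0 < 1 - γ := by linarith [hγ.2]
  set τ : ℝ := ε / (1 - γ) with hτ
  have hτ0 : 0 < τ := div_pos hε hγ'
  have hτε : (1 - γ) * τ = ε := by rw [hτ]; field_simp
  have hyneg : ∀ r, 0 ≤ r → ε ≤ y r := fun r hr => hy00 ▸ hymono hr
  set z : ℝ → ℝ := fun t => if t ≤ τ then (1 - γ) * max t 0 else y (t - τ) with hz
  have hzc : Continuous z := by
    refine Continuous.if_le (by fun_prop) (by fun_prop) continuous_id continuous_const ?_
    rintro t rfl
    rw [max_eq_left hτ0.le, hτε, sub_self, hy00]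
  have hz0 : ∀ t, 0 ≤ z t := fun t => by
    simp only [hz]
    split_ifs with h
    · positivity
    · exact hε.le.trans (hyneg _ (by linarith))
  have hint := fun a b => intervalIntegrable_comp_of_nonneg hδm hδ hzc.measurable hz0 a b
  have hlow : ∀ t, 0 ≤ t → t ≤ τ → ∫ s in (0:ℝ)..t, δ (z s) = γ * t := by
    intro t ht htτ
    rw [intervalIntegral.integral_congr (g := fun _ => γ)]
    · simp [mul_comm]
    · intro s hs
      rw [uIcc_of_le ht] at hs
      have h1 : z s = (1 - γ) * s := by simp [hz, hs.2.trans htτ, hs.1]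
      have h2 : (1 - γ) * s ≤ ε := hτε ▸ mul_le_mul_of_nonneg_left (hs.2.trans htτ) hγ'.le
      simp only [h1]
      exact hconst _ ⟨mul_nonneg hγ'.le hs.1, h2⟩
  refine ⟨z, ⟨hzc.continuousOn, fun t ht => ?_⟩, fun t _ => hz0 t⟩
  rw [intervalIntegral.integral_sub intervalIntegrable_const (hint 0 t),
    intervalIntegral.integral_const, smul_eq_mul, mul_one, sub_zero, zero_add]
  rcases le_total t τ with h | h
  · rw [hlow t ht h]
    simp only [hz, if_pos h, max_eq_left ht]
    ring
  · rw [← intervalIntegral.integral_add_adjacent_intervals (hint 0 τ) (hint τ t),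
      hlow τ hτ0.le le_rfl]
    have hzy : ∀ s, τ ≤ s → z s = y (s - τ) := by
      intro s hs
      rcases hs.eq_or_lt with rfl | hs
      · simp [hz, hτ0.le, hτε, hy00]
      · simp [hz, hs]
    have h1 : ∫ s in τ..t, δ (z s) = ∫ s in τ..t, δ (y (s - τ)) := by
      refine intervalIntegral.integral_congr fun s hs => ?_
      rw [uIcc_of_le h] at hs
      simp only [hzy s hs.1]
    rw [h1, intervalIntegral.integral_comp_sub_right (fun s => δ (y s)), sub_self,
      hyint _ (by linarith), hzy t h]
    linarith

lemma exists_isFlow_le {δ : ℝ → ℝ} (hδm : Measurable δ)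
    (hδ : ∀ y, 0 ≤ y → δ y ∈ Ico (0 : ℝ) 1)
    (hflow : AdmitsUniqueFlow δ) {γ ε : ℝ} (hγ : γ ∈ Ico (0 : ℝ) 1) (hε : 0 < ε)
    (hconst : ∀ y ∈ Icc (0:ℝ) ε, δ y = γ) {y₀ : ℝ} (hy₀ : 0 ≤ y₀) :
    ∃ y, IsFlow δ y₀ y ∧ ∀ t, 0 ≤ t → 0 ≤ y t := by
  rcases hy₀.eq_or_lt with rfl | h
  · exact exists_isFlow_zero hδm hδ hflow hγ hε hconst
  · obtain ⟨y, hy⟩ := (hflow y₀ hy₀).1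
    exact ⟨y, hy, fun t ht => hy₀.trans (hy.le_of_pos hδ h ht)⟩


/-- `(K, M)` dominates, on the time set `I`, the system
`K = max 0 (sup (H(M) - X))`, `M = max c (sup (X + K))`. -/
structure IsSupersolution (H X : ℝ → ℝ) (c : ℝ) (I : Set ℝ) (K M : ℝ → ℝ) : Prop where
  mono_fst : MonotoneOn K I
  mono_snd : MonotoneOn M I
  nonneg : ∀ s ∈ I, 0 ≤ K s
  le_snd : ∀ s ∈ I, c ≤ M s
  add_le : ∀ s ∈ I, X s + K s ≤ M s
  sub_le : ∀ s ∈ I, H (M s) - X s ≤ K s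

lemma IsSupersolution.mono {H X : ℝ → ℝ} {c : ℝ} {I J : Set ℝ} {K M : ℝ → ℝ}
    (h : IsSupersolution H X c I K M) (hJ : J ⊆ I) : IsSupersolution H X c J K M :=
  ⟨h.1.mono hJ, h.2.mono hJ, fun s hs => h.3 s (hJ hs), fun s hs => h.4 s (hJ hs),
    fun s hs => h.5 s (hJ hs), fun s hs => h.6 s (hJ hs)⟩

/-- There is a bounded supersolution on `I`. -/
def HasSupersolution (H X : ℝ → ℝ) (c : ℝ) (I : Set ℝ) : Prop :=
  ∃ (K M : ℝ → ℝ) (C : ℝ), IsSupersolution H X c I K M ∧ ∀ s ∈ I, K s ≤ C ∧ M s ≤ C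

/-- A bounded supersolution extends across a time set on which `X` oscillates by at most `η`. -/
lemma HasSupersolution.extend {H X : ℝ → ℝ} {c η a : ℝ} {I J : Set ℝ}
    (hH : ∀ m, c + 1 ≤ m → H m ≤ m - η) (hIJ : ∀ s ∈ I, ∀ u ∈ J, u ∉ I → s ≤ u)
    (hX : ∀ u ∈ J, u ∉ I → X u ∈ Icc a (a + η)) (hI : HasSupersolution H X c I) :
    HasSupersolution H X c J := by
  classical
  obtain ⟨K, M, C, h, hC⟩ := hI
  obtain ⟨B, hB0, hBC, hBaC, hBac⟩ :
      ∃ B : ℝ, 0 ≤ B ∧ C ≤ B ∧ C ≤ B + a + η ∧ c + 1 ≤ B + a + η :=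
    ⟨max (max 0 C) (max (C - a - η) (c + 1 - a - η)), by simp, by simp,
      by linarith [(le_max_left (C - a - η) (c + 1 - a - η)).trans (le_max_right (max 0 C) _)],
      by linarith [(le_max_right (C - a - η) (c + 1 - a - η)).trans (le_max_right (max 0 C) _)]⟩
  refine ⟨fun s => if s ∈ I then K s else B, fun s => if s ∈ I then M s else B + a + η,
    max B (B + a + η), ⟨?_, ?_, ?_, ?_, ?_, ?_⟩, ?_⟩
  · intro s hs u hu hsu
    by_cases h1 : s ∈ I <;> by_cases h2 : u ∈ I <;> simp only [h1, h2, if_true, if_false]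
    · exact h.1 h1 h2 hsu
    · exact (hC s h1).1.trans hBC
    · have := hIJ u h2 s hs h1
      rw [le_antisymm hsu this] at h1
      exact absurd h2 h1
    · exact le_rfl
  · intro s hs u hu hsu
    by_cases h1 : s ∈ I <;> by_cases h2 : u ∈ I <;> simp only [h1, h2, if_true, if_false]
    · exact h.2 h1 h2 hsu
    · exact (hC s h1).2.trans hBaC
    · have := hIJ u h2 s hs h1
      rw [le_antisymm hsu this] at h1
      exact absurd h2 h1
    · exact le_rfl
  · intro s hs
    by_cases h1 : s ∈ I <;> simp only [h1, if_true, if_false]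
    exacts [h.3 s h1, hB0]
  · intro s hs
    by_cases h1 : s ∈ I <;> simp only [h1, if_true, if_false]
    exacts [h.4 s h1, by linarith]
  · intro s hs
    by_cases h1 : s ∈ I <;> simp only [h1, if_true, if_false]
    exacts [h.5 s h1, by linarith [(hX s hs h1).2]]
  · intro s hs
    by_cases h1 : s ∈ I <;> simp only [h1, if_true, if_false]
    exacts [h.6 s h1, by linarith [(hX s hs h1).1, hH _ hBac]]
  · intro s hs
    by_cases h1 : s ∈ I <;> simp only [h1, if_true, if_false]
    · exact ⟨((hC s h1).1.trans hBC).trans (le_max_left _ _),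
        ((hC s h1).2.trans hBaC).trans (le_max_right _ _)⟩
    · exact ⟨le_max_left _ _, le_max_right _ _⟩

lemma hasSupersolution_Icc {H X : ℝ → ℝ} {c η : ℝ} (hη : 0 < η)
    (hH : ∀ m, c + 1 ≤ m → H m ≤ m - η) (hX : Cadlag X) {t : ℝ} (ht : 0 ≤ t) :
    HasSupersolution H X c (Icc 0 t) := by
  by_contra hcon
  set A : Set ℝ := {s | 0 ≤ s ∧ HasSupersolution H X c (Icc 0 s)} with hA
  have hdown : ∀ s ∈ A, ∀ r, 0 ≤ r → r ≤ s → r ∈ A := by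
    rintro s ⟨-, K, M, C, h, hC⟩ r hr hrs
    have hsub : Icc 0 r ⊆ Icc 0 s := Icc_subset_Icc_right hrs
    exact ⟨hr, K, M, C, h.mono hsub, fun u hu => hC u (hsub hu)⟩
  have hub : ∀ s ∈ A, s ≤ t := fun s hs => by
    by_contra! h
    exact hcon (hdown s hs t ht h.le).2
  have h0 : (0 : ℝ) ∈ A := by
    refine ⟨le_rfl, HasSupersolution.extend (I := ∅) (a := X 0) hH (by simp) ?_
      ⟨0, 0, 0, ⟨monotoneOn_const, monotoneOn_const, by simp, by simp, by simp, by simp⟩, by simp⟩⟩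
    intro u hu _
    obtain rfl : u = 0 := le_antisymm hu.2 hu.1
    exact ⟨le_rfl, by linarith⟩
  have hbdd : BddAbove A := ⟨t, hub⟩
  set b := sSup A with hb
  have hb0 : 0 ≤ b := le_csSup hbdd h0
  have hbA : b ∈ A := by
    rcases hb0.eq_or_lt with h | hbpos
    · rw [← h]; exact h0
    obtain ⟨l, hl⟩ := hX.2 b hbpos
    have hev : ∀ᶠ s in nhdsWithin b (Iio b), X s ∈ Icc (l - η / 2) (l - η / 2 + η) :=
      hl.eventually (Icc_mem_nhds (by linarith) (by linarith))
    obtain ⟨r, hr, hrb⟩ := (mem_nhdsLT_iff_exists_Ioo_subset' hbpos).1 hev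
    obtain ⟨s, hsA, hrs⟩ := exists_lt_of_lt_csSup ⟨0, h0⟩ (show r < sSup A from hr)
    by_cases hsb : s = b
    · exact hsb ▸ hsA
    have hsb' : s < b := lt_of_le_of_ne (le_csSup hbdd hsA) hsb
    have h1 : HasSupersolution H X c (Ico 0 b) :=
      HasSupersolution.extend (I := Icc 0 s) (a := l - η / 2) hH
        (fun v hv u hu hu' => hv.2.trans (not_le.1 fun h => hu' ⟨hu.1, h⟩).le)
        (fun u hu hu' => hrb ⟨hrs.trans (not_le.1 fun h => hu' ⟨hu.1, h⟩), hu.2⟩) hsA.2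
    refine ⟨hb0, HasSupersolution.extend (a := X b) hH
      (fun v hv u hu hu' => hv.2.le.trans (not_lt.1 fun h => hu' ⟨hu.1, h⟩)) ?_ h1⟩
    intro u hu hu'
    obtain rfl : u = b := le_antisymm hu.2 (not_lt.1 fun h => hu' ⟨hu.1, h⟩)
    exact ⟨le_rfl, by linarith⟩
  have hev : ∀ᶠ s in nhdsWithin b (Ici b), X s ∈ Icc (X b - η / 2) (X b - η / 2 + η) :=
    (hX.1 b hb0).eventually (Icc_mem_nhds (by linarith) (by linarith))
  obtain ⟨u, hu, hub'⟩ := mem_nhdsGE_iff_exists_Icc_subset.1 hev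
  have : u ∈ A := ⟨hb0.trans hu.le, HasSupersolution.extend (I := Icc 0 b) (a := X b - η / 2) hH
    (fun v hv w hw hw' => hv.2.trans (not_le.1 fun h => hw' ⟨hw.1, h⟩).le)
    (fun w hw hw' => hub' ⟨(not_le.1 fun h => hw' ⟨hw.1, h⟩).le, hw.2⟩) hbA.2⟩
  exact absurd (le_csSup hbdd this) (not_le.2 hu)

/-- Knaster–Tarski: the infimum of all supersolutions solves the coupled supremum system. -/
lemma exists_coupled_suprema {H X : ℝ → ℝ} {c : ℝ} (hHmono : Monotone H)
    (hsup : ∀ t, 0 ≤ t → HasSupersolution H X c (Icc 0 t)) :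
    ∃ K M : ℝ → ℝ, Monotone K ∧ Monotone M ∧ (∀ t, K (max t 0) = K t) ∧
      (∀ t, M (max t 0) = M t) ∧
      (∀ t, 0 ≤ t → IsLUB (insert 0 ((fun s => H (M s) - X s) '' Icc 0 t)) (K t)) ∧
      ∀ t, 0 ≤ t → IsLUB (insert c ((fun s => X s + K s) '' Icc 0 t)) (M t) := by
  set S : ℝ → Set ((ℝ → ℝ) × (ℝ → ℝ)) :=
    fun t => {p | IsSupersolution H X c (Icc 0 t) p.1 p.2} with hS
  have hne : ∀ t, 0 ≤ t → (S t).Nonempty := fun t ht => by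
    obtain ⟨K, M, C, h, -⟩ := hsup t ht
    exact ⟨(K, M), h⟩
  set K : ℝ → ℝ := fun t => sInf ((fun p => p.1 (max t 0)) '' S (max t 0)) with hK
  set M : ℝ → ℝ := fun t => sInf ((fun p => p.2 (max t 0)) '' S (max t 0)) with hM
  have hKle : ∀ s t, 0 ≤ s → s ≤ t → ∀ p ∈ S t, K s ≤ p.1 s := by
    intro s t hs hst p hp
    simp only [hK, max_eq_left hs]
    refine csInf_le ⟨0, ?_⟩ ⟨p, hp.mono (Icc_subset_Icc_right hst), rfl⟩
    rintro _ ⟨q, hq, rfl⟩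
    exact hq.nonneg s ⟨hs, le_rfl⟩
  have hMle : ∀ s t, 0 ≤ s → s ≤ t → ∀ p ∈ S t, M s ≤ p.2 s := by
    intro s t hs hst p hp
    simp only [hM, max_eq_left hs]
    refine csInf_le ⟨c, ?_⟩ ⟨p, hp.mono (Icc_subset_Icc_right hst), rfl⟩
    rintro _ ⟨q, hq, rfl⟩
    exact hq.le_snd s ⟨hs, le_rfl⟩
  have hleK : ∀ t, 0 ≤ t → ∀ b, (∀ p ∈ S t, b ≤ p.1 t) → b ≤ K t := by
    intro t ht b h
    simp only [hK, max_eq_left ht]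
    refine le_csInf ((hne t ht).image _) ?_
    rintro _ ⟨q, hq, rfl⟩
    exact h q hq
  have hleM : ∀ t, 0 ≤ t → ∀ b, (∀ p ∈ S t, b ≤ p.2 t) → b ≤ M t := by
    intro t ht b h
    simp only [hM, max_eq_left ht]
    refine le_csInf ((hne t ht).image _) ?_
    rintro _ ⟨q, hq, rfl⟩
    exact h q hq
  have hKmax : ∀ t, K (max t 0) = K t := fun t => by simp [hK]
  have hMmax : ∀ t, M (max t 0) = M t := fun t => by simp [hM]
  have hKmono : Monotone K := by
    intro s t hst
    rw [← hKmax s, ← hKmax t]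
    have hst' : max s 0 ≤ max t 0 := max_le_max_right 0 hst
    have hs0 : 0 ≤ max s 0 := le_max_right _ _
    exact hleK _ (hs0.trans hst') _ fun p hp => (hKle _ _ hs0 hst' p hp).trans
      (hp.mono_fst ⟨hs0, hst'⟩ ⟨hs0.trans hst', le_rfl⟩ hst')
  have hMmono : Monotone M := by
    intro s t hst
    rw [← hMmax s, ← hMmax t]
    have hst' : max s 0 ≤ max t 0 := max_le_max_right 0 hst
    have hs0 : 0 ≤ max s 0 := le_max_right _ _
    exact hleM _ (hs0.trans hst') _ fun p hp => (hMle _ _ hs0 hst' p hp).trans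
      (hp.mono_snd ⟨hs0, hst'⟩ ⟨hs0.trans hst', le_rfl⟩ hst')
  have hKM : ∀ t, IsSupersolution H X c (Icc 0 t) K M := fun t =>
    { mono_fst := hKmono.monotoneOn _
      mono_snd := hMmono.monotoneOn _
      nonneg := fun s hs => hleK s hs.1 _ fun p hp => hp.nonneg s ⟨hs.1, le_rfl⟩
      le_snd := fun s hs => hleM s hs.1 _ fun p hp => hp.le_snd s ⟨hs.1, le_rfl⟩
      add_le := fun s hs => hleM s hs.1 _ fun p hp => by
        linarith [hp.add_le s ⟨hs.1, le_rfl⟩, hKle s s hs.1 le_rfl p hp]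
      sub_le := fun s hs => hleK s hs.1 _ fun p hp => by
        linarith [hp.sub_le s ⟨hs.1, le_rfl⟩, hHmono (hMle s s hs.1 le_rfl p hp)] }
  refine ⟨K, M, hKmono, hMmono, hKmax, hMmax, fun t ht => ⟨?_, ?_⟩, fun t ht => ⟨?_, ?_⟩⟩
  · rintro _ (rfl | ⟨s, hs, rfl⟩)
    · exact (hKM t).nonneg t ⟨ht, le_rfl⟩
    · exact ((hKM t).sub_le s hs).trans (hKmono hs.2)
  · intro b hb
    have : IsSupersolution H X c (Icc 0 t) (fun s => min (K s) b) M :=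
      { mono_fst := fun u hu v hv huv => min_le_min_right b (hKmono huv)
        mono_snd := (hKM t).mono_snd
        nonneg := fun s hs => le_min ((hKM t).nonneg s hs) (hb (mem_insert _ _))
        le_snd := (hKM t).le_snd
        add_le := fun s hs => by linarith [(hKM t).add_le s hs, min_le_left (K s) b]
        sub_le := fun s hs =>
          le_min ((hKM t).sub_le s hs) (hb (mem_insert_of_mem _ ⟨s, hs, rfl⟩)) }
    exact (hKle t t ht le_rfl (_, _) this).trans (min_le_right _ _)
  · rintro _ (rfl | ⟨s, hs, rfl⟩)
    · exact (hKM t).le_snd t ⟨ht, le_rfl⟩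
    · exact ((hKM t).add_le s hs).trans (hMmono hs.2)
  · intro b hb
    have : IsSupersolution H X c (Icc 0 t) K (fun s => min (M s) b) :=
      { mono_fst := (hKM t).mono_fst
        mono_snd := fun u hu v hv huv => min_le_min_right b (hMmono huv)
        nonneg := (hKM t).nonneg
        le_snd := fun s hs => le_min ((hKM t).le_snd s hs) (hb (mem_insert _ _))
        add_le := fun s hs =>
          le_min ((hKM t).add_le s hs) (hb (mem_insert_of_mem _ ⟨s, hs, rfl⟩))
        sub_le := fun s hs => by
          linarith [(hKM t).sub_le s hs, hHmono (min_le_left (M s) b)] }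
    exact (hMle t t ht le_rfl (_, _) this).trans (min_le_right _ _)

lemma le_max_leftLim_of_isLUB {R Z : ℝ → ℝ} {c : ℝ} (hR : Monotone R)
    (hlub : ∀ t, 0 ≤ t → IsLUB (insert c (Z '' Icc 0 t)) (R t)) {t : ℝ} (ht : 0 < t) :
    R t ≤ max (leftLim R t) (Z t) := by
  refine (hlub t ht.le).2 ?_
  rintro _ (rfl | ⟨s, hs, rfl⟩)
  · exact ((hlub 0 le_rfl).1 (mem_insert _ _)).trans
      ((hR.le_leftLim ht).trans (le_max_left _ _))
  · rcases hs.2.eq_or_lt with rfl | h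
    · exact le_max_right _ _
    · exact ((hlub s hs.1).1 (mem_insert_of_mem _ ⟨s, ⟨hs.1, le_rfl⟩, rfl⟩)).trans
        ((hR.le_leftLim h).trans (le_max_left _ _))

lemma le_max_of_isLUB {R Z : ℝ → ℝ} {c : ℝ}
    (hlub : ∀ t, 0 ≤ t → IsLUB (insert c (Z '' Icc 0 t)) (R t)) {t u b : ℝ} (ht : 0 ≤ t)
    (htu : t ≤ u) (hb : ∀ s, t < s → s ≤ u → Z s ≤ b) : R u ≤ max (R t) b := by
  refine (hlub u (ht.trans htu)).2 ?_
  rintro _ (rfl | ⟨s, hs, rfl⟩)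
  · exact ((hlub t ht).1 (mem_insert _ _)).trans (le_max_left _ _)
  · rcases le_or_gt s t with h | h
    · exact ((hlub t ht).1 (mem_insert_of_mem _ ⟨s, ⟨hs.1, h⟩, rfl⟩)).trans (le_max_left _ _)
    · exact (hb s h hs.2).trans (le_max_right _ _)

lemma le_of_isLUB {R Z : ℝ → ℝ} {c : ℝ}
    (hlub : ∀ t, 0 ≤ t → IsLUB (insert c (Z '' Icc 0 t)) (R t)) {t : ℝ} (ht : 0 ≤ t) :
    Z t ≤ R t :=
  (hlub t ht).1 (mem_insert_of_mem _ ⟨t, ⟨ht, le_rfl⟩, rfl⟩)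

lemma continuousWithinAt_Ici_of_rightLim_eq {R : ℝ → ℝ} (hR : Monotone R) {t : ℝ}
    (h : rightLim R t = R t) : ContinuousWithinAt R (Ici t) t :=
  continuousWithinAt_Ioi_iff_Ici.1 (hR.continuousWithinAt_Ioi_iff_rightLim_eq.2 h)

/-- Solutions of the coupled supremum system are right-continuous. -/
lemma rightLim_eq_of_coupled {H X K M : ℝ → ℝ} {c : ℝ}
    (hHlip : ∀ a b, a ≤ b → H b - H a ≤ b - a) (hHlt : ∀ m, c < m → H m < m)
    (hX : Cadlag X) (hK : Monotone K) (hM : Monotone M)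
    (hKlub : ∀ t, 0 ≤ t → IsLUB (insert 0 ((fun s => H (M s) - X s) '' Icc 0 t)) (K t))
    (hMlub : ∀ t, 0 ≤ t → IsLUB (insert c ((fun s => X s + K s) '' Icc 0 t)) (M t))
    (hHmono : Monotone H) {t : ℝ} (ht : 0 ≤ t) :
    rightLim K t = K t ∧ rightLim M t = M t := by
  have hKt : K t ≤ rightLim K t := hK.le_rightLim le_rfl
  have hMt : M t ≤ rightLim M t := hM.le_rightLim le_rfl
  have hcM : c ≤ M t := (hMlub t ht).1 (mem_insert _ _)
  have hnear : ∀ e, 0 < e → ∃ u, t < u ∧ K u ≤ rightLim K t + e ∧ M u ≤ rightLim M t + e ∧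
      ∀ s, t < s → s ≤ u → |X s - X t| ≤ e := by
    intro e he
    have h1 := (hK.tendsto_rightLim t).eventually (Iic_mem_nhds (show _ < rightLim K t + e by linarith))
    have h2 := (hM.tendsto_rightLim t).eventually (Iic_mem_nhds (show _ < rightLim M t + e by linarith))
    have h3 : ∀ᶠ s in nhdsWithin t (Ioi t), |X s - X t| ≤ e := by
      filter_upwards [((hX.1 t ht).mono Ioi_subset_Ici_self).eventually (Metric.closedBall_mem_nhds _ he)]
        with s hs
      simpa [Real.dist_eq] using hs
    obtain ⟨u, hu, hsub⟩ := mem_nhdsGT_iff_exists_Ioc_subset.1 (h1.and (h2.and h3))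
    have hu' := hsub ⟨hu, le_rfl⟩
    exact ⟨u, hu, hu'.1, hu'.2.1, fun s hs hsu => (hsub ⟨hs, hsu⟩).2.2⟩
  have hm : rightLim M t ≤ max (M t) (X t + rightLim K t) := by
    refine le_of_forall_pos_le_add fun e he => ?_
    obtain ⟨u, htu, hu1, hu2, hu3⟩ := hnear (e / 2) (by linarith)
    have := le_max_of_isLUB hMlub ht htu.le (b := X t + rightLim K t + e) fun s hs hsu => by
      have := (abs_le.1 (hu3 s hs hsu)).2
      have := hK hsu
      linarith
    refine (hM.rightLim_le htu).trans (this.trans (max_le ?_ ?_))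
    · linarith [le_max_left (M t) (X t + rightLim K t)]
    · linarith [le_max_right (M t) (X t + rightLim K t)]
  have hk : rightLim K t ≤ max (K t) (H (rightLim M t) - X t) := by
    refine le_of_forall_pos_le_add fun e he => ?_
    obtain ⟨u, htu, hu1, hu2, hu3⟩ := hnear (e / 2) (by linarith)
    have := le_max_of_isLUB hKlub ht htu.le (b := H (rightLim M t) - X t + e) fun s hs hsu => by
      have h1 := (abs_le.1 (hu3 s hs hsu)).1
      have h2 := hHmono ((hM hsu).trans hu2)
      have h3 := hHlip (rightLim M t) (rightLim M t + e / 2) (by linarith)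
      linarith
    refine (hK.rightLim_le htu).trans (this.trans (max_le ?_ ?_))
    · linarith [le_max_left (K t) (H (rightLim M t) - X t)]
    · linarith [le_max_right (K t) (H (rightLim M t) - X t)]
  have h1 : H (M t) - X t ≤ K t := le_of_isLUB hKlub ht
  have h2 : X t + K t ≤ M t := le_of_isLUB hMlub ht
  have hk' : rightLim K t = K t := by
    by_contra hne
    have hlt : K t < rightLim K t := lt_of_le_of_ne hKt (Ne.symm hne)
    have h3 : rightLim K t ≤ H (rightLim M t) - X t := (le_max_iff.1 hk).resolve_left (not_le.2 hlt)
    rcases hMt.eq_or_lt with h | h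
    · rw [← h] at h3
      linarith
    · have h4 := (le_max_iff.1 hm).resolve_left (not_le.2 h)
      linarith [hHlt _ (hcM.trans_lt h)]
  refine ⟨hk', le_antisymm (hm.trans (max_le le_rfl ?_)) hMt⟩
  rw [hk']
  exact h2

/-- Absence of positive jumps makes the running maximum left-continuous. -/
lemma leftLim_eq_of_coupled {H X K M : ℝ → ℝ} {c : ℝ} (hHlt : ∀ m, c < m → H m < m)
    (hX : Cadlag X) (hXj : NoPosJumps X) (hK : Monotone K) (hM : Monotone M)
    (hKlub : ∀ t, 0 ≤ t → IsLUB (insert 0 ((fun s => H (M s) - X s) '' Icc 0 t)) (K t))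
    (hMlub : ∀ t, 0 ≤ t → IsLUB (insert c ((fun s => X s + K s) '' Icc 0 t)) (M t))
    {t : ℝ} (ht : 0 < t) : leftLim M t = M t := by
  have h1 := le_max_leftLim_of_isLUB hM hMlub ht
  have h2 := le_max_leftLim_of_isLUB hK hKlub ht
  have hXl : Tendsto X (nhdsWithin t (Iio t)) (nhds (leftLim X t)) :=
    tendsto_leftLim_of_tendsto (hX.2 t ht)
  have h3 : leftLim X t + leftLim K t ≤ leftLim M t := by
    refine le_of_tendsto_of_tendsto (hXl.add (hK.tendsto_leftLim t)) (hM.tendsto_leftLim t) ?_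
    filter_upwards [Ioo_mem_nhdsLT ht] with s hs using le_of_isLUB hMlub hs.1.le
  refine le_antisymm (hM.leftLim_le le_rfl) ?_
  by_contra! hlt
  have h4 := (le_max_iff.1 h1).resolve_left (not_le.2 hlt)
  have h5 : K t ≤ H (M t) - X t := by
    refine (le_max_iff.1 h2).resolve_left fun h => ?_
    linarith [hXj t ht]
  have hcM : c ≤ leftLim M t :=
    ((hMlub 0 le_rfl).1 (mem_insert _ _)).trans (hM.le_leftLim ht)
  linarith [hHlt _ (hcM.trans_lt hlt)]

/-- A continuous Stieltjes function pushes its own measure forward to Lebesgue measure. -/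
lemma StieltjesFunction.map_measure_restrict_Ioc (F : StieltjesFunction ℝ) (hF : Continuous F)
    {a b : ℝ} (hab : a ≤ b) :
    (F.measure.restrict (Ioc a b)).map F = volume.restrict (Ioc (F a) (F b)) := by
  have : IsFiniteMeasure (F.measure.restrict (Ioc a b)) :=
    ⟨by simp [F.measure_Ioc]⟩
  refine Measure.ext_of_Iic _ _ fun x => ?_
  rw [Measure.map_apply hF.measurable measurableSet_Iic,
    Measure.restrict_apply (hF.measurable measurableSet_Iic),
    Measure.restrict_apply measurableSet_Iic]
  rcases lt_or_ge x (F a) with h | h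
  · have h1 : F ⁻¹' Iic x ∩ Ioc a b = ∅ :=
      eq_empty_of_forall_notMem fun s hs => by
        have h2 : F s ≤ x := hs.1
        linarith [F.mono hs.2.1.le]
    have h2 : Iic x ∩ Ioc (F a) (F b) = ∅ :=
      eq_empty_of_forall_notMem fun s hs => by
        have h2 : s ≤ x := hs.1
        linarith [hs.2.1]
    simp [h1, h2]
  rcases le_or_gt (F b) x with h' | h'
  · have h1 : F ⁻¹' Iic x ∩ Ioc a b = Ioc a b :=
      inter_eq_right.2 fun s hs => (F.mono hs.2).trans h'
    have h2 : Iic x ∩ Ioc (F a) (F b) = Ioc (F a) (F b) :=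
      inter_eq_right.2 fun s hs => hs.2.trans h'
    rw [h1, h2, F.measure_Ioc, Real.volume_Ioc]
  have hcpt : IsCompact (Icc a b ∩ F ⁻¹' Iic x) := isCompact_Icc.inter_right (isClosed_Iic.preimage hF)
  obtain ⟨u, ⟨hu, hux⟩, hgreat⟩ := hcpt.exists_isGreatest ⟨a, ⟨le_rfl, hab⟩, h⟩
  obtain ⟨v, hv, hvx⟩ := intermediate_value_Icc hab hF.continuousOn ⟨h, h'.le⟩
  have hFu : F u = x := le_antisymm hux (hvx ▸ F.mono (hgreat ⟨hv, hvx.le⟩))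
  have h1 : F ⁻¹' Iic x ∩ Ioc a b = Ioc a u := by
    ext s
    refine ⟨fun hs => ⟨hs.2.1, hgreat ⟨⟨hs.2.1.le, hs.2.2⟩, hs.1⟩⟩, fun hs => ⟨?_, hs.1, hs.2.trans hu.2⟩⟩
    exact (F.mono hs.2).trans hFu.le
  have h2 : Iic x ∩ Ioc (F a) (F b) = Ioc (F a) x := by
    ext s
    exact ⟨fun hs => ⟨hs.2.1, hs.1⟩, fun hs => ⟨hs.2, hs.1, hs.2.trans h'.le⟩⟩
  rw [h1, h2, F.measure_Ioc, Real.volume_Ioc, hFu]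

lemma StieltjesFunction.setIntegral_comp (F : StieltjesFunction ℝ) (hF : Continuous F) {g : ℝ → ℝ}
    (hg : Measurable g) {a b : ℝ} (hab : a ≤ b) :
    ∫ s in Ioc a b, g (F s) ∂F.measure = ∫ x in F a..F b, g x := by
  rw [intervalIntegral.integral_of_le (F.mono hab), ← F.map_measure_restrict_Ioc hF hab,
    integral_map hF.measurable.aemeasurable hg.aestronglyMeasurable]

/-- A set is null if each of its points starts a null interval to its right. -/
lemma measure_null_of_forall_exists_Ico {μ : Measure ℝ} {S : Set ℝ}
    (h : ∀ s ∈ S, ∃ u, s < u ∧ μ (Ico s u) = 0) : μ S = 0 := by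
  have hsub : S ⊆ ⋃ q : ℚ, {s | s < q ∧ μ (Ico s q) = 0} := by
    intro s hs
    obtain ⟨u, hsu, hu⟩ := h s hs
    obtain ⟨q, hq1, hq2⟩ := exists_rat_btwn hsu
    exact mem_iUnion.2 ⟨q, hq1, measure_mono_null (Ico_subset_Ico_right hq2.le) hu⟩
  refine measure_mono_null hsub (measure_iUnion_null fun q => ?_)
  set T : Set ℝ := {s | s < q ∧ μ (Ico s q) = 0}
  by_cases hl : ∃ a, IsLeast T a
  · obtain ⟨a, ha, hle⟩ := hl
    have hTa : T ⊆ Ico a q := fun s hs => ⟨hle hs, hs.1⟩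
    exact measure_mono_null hTa ha.2
  · have hsub' : T ⊆ ⋃ r ∈ {r : ℚ | μ (Ico (r : ℝ) q) = 0}, Ico (r : ℝ) q := by
      intro s hs
      have : ∃ s' ∈ T, s' < s := by
        by_contra! hcon
        exact hl ⟨s, hs, hcon⟩
      obtain ⟨s', hs', hlt⟩ := this
      obtain ⟨r, hr1, hr2⟩ := exists_rat_btwn hlt
      simp only [mem_iUnion]
      exact ⟨r, measure_mono_null (Ico_subset_Ico_left hr1.le) hs'.2, hr2.le, hs.1⟩
    exact measure_mono_null hsub'
      ((measure_biUnion_null_iff (to_countable _)).2 fun r hr => hr)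

lemma StieltjesFunction.measure_null_of_forall_le_leftLim (F : StieltjesFunction ℝ) {S : Set ℝ}
    (h : ∀ s ∈ S, ∃ u, s < u ∧ F u ≤ leftLim F s) : F.measure S = 0 := by
  refine measure_null_of_forall_exists_Ico fun s hs => ?_
  obtain ⟨u, hsu, hu⟩ := h s hs
  refine ⟨u, hsu, measure_mono_null Ico_subset_Icc_self ?_⟩
  rw [F.measure_Icc, ENNReal.ofReal_eq_zero]
  linarith

lemma exists_gt_le_of_isLUB {R Z : ℝ → ℝ} {c : ℝ}
    (hlub : ∀ t, 0 ≤ t → IsLUB (insert c (Z '' Icc 0 t)) (R t)) {t : ℝ} (ht : 0 ≤ t)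
    (hZ : ContinuousWithinAt Z (Ici t) t) (hlt : Z t < R t) : ∃ u, t < u ∧ R u ≤ R t := by
  obtain ⟨u, hu, hsub⟩ := mem_nhdsGE_iff_exists_Icc_subset.1
    (hZ.eventually (Iic_mem_nhds hlt))
  refine ⟨u, hu, ?_⟩
  have := le_max_of_isLUB hlub ht (le_of_lt hu) (b := R t) fun s hs hsu => hsub ⟨hs.le, hsu⟩
  rwa [max_self] at this

lemma lsMeasureAux_eq (F : StieltjesFunction ℝ) {f : ℝ → ℝ} (h : ∀ t, f (max t 0) = F t) :
    lsMeasureAux f = F.measure := by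
  have h' : (fun t => f (max t 0)) = F := funext h
  have hcond : Monotone (fun t => f (max t 0)) ∧
      ∀ x : ℝ, ContinuousWithinAt (fun t => f (max t 0)) (Set.Ici x) x := by
    rw [h']
    exact ⟨F.mono, F.right_continuous⟩
  rw [lsMeasureAux, dif_pos hcond]
  congr 1
  exact StieltjesFunction.ext h

lemma lsMeasure_restrict_Ioc (F : StieltjesFunction ℝ) {f : ℝ → ℝ} (h : ∀ t, f (max t 0) = F t)
    (t : ℝ) : (lsMeasure f).restrict (Ioc 0 t) = F.measure.restrict (Ioc 0 t) := by
  classical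
  rw [lsMeasure, lsMeasureAux_eq F h, Measure.restrict_add, Measure.restrict_smul,
    restrict_dirac' measurableSet_Ioc]
  simp

lemma runSup_eq_of_isLUB {c t : ℝ} {Z : ℝ → ℝ} {m : ℝ} (ht : 0 ≤ t)
    (h : IsLUB (insert c (Z '' Icc 0 t)) m) : runSup c Z t = m := by
  have hne : (Z '' Icc 0 t).Nonempty := (nonempty_Icc.2 ht).image _
  have hbdd : BddAbove (Z '' Icc 0 t) := ⟨m, fun x hx => h.1 (mem_insert_of_mem _ hx)⟩
  rw [runSup, runSSup, ← csSup_insert hbdd hne, h.csSup_eq (insert_nonempty _ _)]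

lemma le_leftLim_of_nonpos {R : ℝ → ℝ} (hR : Monotone R) (hmax : ∀ t, R (max t 0) = R t) {t : ℝ}
    (ht : t ≤ 0) : R t ≤ leftLim R t := by
  have h : R (t - 1) = R t := by
    rw [← hmax t, ← hmax (t - 1), max_eq_right ht, max_eq_right (by linarith)]
  exact h ▸ hR.le_leftLim (by linarith)

lemma rightLim_eq_of_nonneg {R : ℝ → ℝ} (hR : Monotone R) (hmax : ∀ t, R (max t 0) = R t)
    (h : ∀ t, 0 ≤ t → rightLim R t = R t) (t : ℝ) : rightLim R t = R t := by
  rcases le_or_gt 0 t with ht | ht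
  · exact h t ht
  · refine le_antisymm ((hR.rightLim_le ht).trans ?_) (hR.le_rightLim le_rfl)
    rw [← hmax t, max_eq_right ht.le]

/-- A solution of the coupled supremum system yields a tax-reflection pair, as soon as the
primitive of the tax rate along the flow is identified with `H`. -/
lemma isTaxReflectionPair_of_coupled {δ H g X K M : ℝ → ℝ} {c : ℝ}
    (hg : Measurable g) (hHmono : Monotone H) (hHcont : Continuous H)
    (hHlip : ∀ a b, a ≤ b → H b - H a ≤ b - a) (hHlt : ∀ m, c < m → H m < m)
    (hgδ : ∀ m, g m = δ (m - H m)) (hgint : ∀ m, c ≤ m → ∫ x in c..m, g x = H m)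
    (hX : Cadlag X) (hXj : NoPosJumps X) (hXc : X 0 ≤ c)
    (hK : Monotone K) (hM : Monotone M)
    (hKmax : ∀ t, K (max t 0) = K t) (hMmax : ∀ t, M (max t 0) = M t)
    (hKlub : ∀ t, 0 ≤ t → IsLUB (insert 0 ((fun s => H (M s) - X s) '' Icc 0 t)) (K t))
    (hMlub : ∀ t, 0 ≤ t → IsLUB (insert c ((fun s => X s + K s) '' Icc 0 t)) (M t)) :
    IsTaxReflectionPair δ X c (fun t => X t + K t - H (M t)) K := by
  have hKr := rightLim_eq_of_nonneg hK hKmax fun t ht =>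
    (rightLim_eq_of_coupled hHlip hHlt hX hK hM hKlub hMlub hHmono ht).1
  have hMr := rightLim_eq_of_nonneg hM hMmax fun t ht =>
    (rightLim_eq_of_coupled hHlip hHlt hX hK hM hKlub hMlub hHmono ht).2
  have hMl : ∀ t, leftLim M t = M t := fun t => by
    rcases lt_or_ge 0 t with ht | ht
    · exact leftLim_eq_of_coupled hHlt hX hXj hK hM hKlub hMlub ht
    · exact le_antisymm (hM.leftLim_le le_rfl) (le_leftLim_of_nonpos hM hMmax ht)
  have hMc : Continuous M := continuous_iff_continuousAt.2 fun t =>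
    hM.continuousAt_iff_leftLim_eq_rightLim.2 ((hMl t).trans (hMr t).symm)
  have hKrc : ∀ t, ContinuousWithinAt K (Ici t) t := fun t =>
    continuousWithinAt_Ici_of_rightLim_eq hK (hKr t)
  have hHM : Continuous fun t => H (M t) := hHcont.comp hMc
  have hM0 : M 0 = c := by
    refine le_antisymm ?_ ((hMlub 0 le_rfl).1 (mem_insert _ _))
    by_contra! hlt
    have h1 : M 0 ≤ max c (X 0 + K 0) := (hMlub 0 le_rfl).2 (by
      rintro _ (rfl | ⟨s, hs, rfl⟩)
      · exact le_max_left _ _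
      · obtain rfl : s = 0 := le_antisymm hs.2 hs.1
        exact le_max_right _ _)
    have h2 : K 0 ≤ max 0 (H (M 0) - X 0) := (hKlub 0 le_rfl).2 (by
      rintro _ (rfl | ⟨s, hs, rfl⟩)
      · exact le_max_left _ _
      · obtain rfl : s = 0 := le_antisymm hs.2 hs.1
        exact le_max_right _ _)
    have h3 := (le_max_iff.1 h1).resolve_left (not_le.2 hlt)
    have h4 := (le_max_iff.1 h2).resolve_left (by linarith)
    linarith [hHlt _ hlt]
  set FM : StieltjesFunction ℝ := ⟨M, hM, fun t => hMc.continuousWithinAt⟩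
  set FK : StieltjesFunction ℝ := ⟨K, hK, hKrc⟩
  refine ⟨⟨fun t ht => ((hX.1 t ht).add (hKrc t)).sub hHM.continuousWithinAt, fun t ht => ?_⟩,
    ⟨fun t _ => hKrc t, fun t _ => ⟨_, hK.tendsto_leftLim t⟩⟩, fun t ht => ?_, hK.monotoneOn _,
    fun t ht => ?_, ?_⟩
  · obtain ⟨l, hl⟩ := hX.2 t ht
    exact ⟨_, (hl.add (hK.tendsto_leftLim t)).sub hHM.continuousWithinAt⟩
  · have : H (M t) - X t ≤ K t := le_of_isLUB hKlub ht
    linarith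
  · have hrun : ∀ s, runSup c (fun s => X s + K s) (max s 0) = FM s := fun s =>
      (runSup_eq_of_isLUB (le_max_right _ _) (hMlub _ (le_max_right _ _))).trans (hMmax s)
    have hnull : FM.measure {s | 0 < s ∧ X s + K s < M s} = 0 :=
      FM.measure_null_of_forall_le_leftLim fun s hs => by
        obtain ⟨u, hsu, hu⟩ := exists_gt_le_of_isLUB hMlub hs.1.le
          ((hX.1 s hs.1.le).add (hKrc s)) hs.2
        exact ⟨u, hsu, hu.trans (hMl s).ge⟩
    have hint : ∫ s in Ioc (0:ℝ) t, δ (X s + K s - H (M s))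
        ∂(lsMeasure (runSup c (fun s => X s + K s))) = H (M t) := by
      rw [lsMeasure_restrict_Ioc FM hrun]
      have hae : ∀ᵐ s ∂(FM.measure.restrict (Ioc 0 t)), δ (X s + K s - H (M s)) = g (FM s) := by
        rw [ae_restrict_iff' measurableSet_Ioc]
        filter_upwards [measure_eq_zero_iff_ae_notMem.1 hnull] with s hs hst
        have h1 : X s + K s = M s := by
          refine le_antisymm (le_of_isLUB hMlub hst.1.le) ?_
          by_contra! h
          exact hs ⟨hst.1, h⟩
        rw [h1, hgδ]
      rw [integral_congr_ae hae, FM.setIntegral_comp hMc hg ht]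
      change ∫ x in (M 0)..(M t), g x = _
      rw [hM0]
      exact hgint _ (hM0 ▸ hM ht)
    rw [hint]
  · have hdir : (ENNReal.ofReal (K 0) • Measure.dirac (0 : ℝ))
        {t : ℝ | 0 ≤ t ∧ 0 < X t + K t - H (M t)} = 0 := by
      by_cases h0 : 0 < X 0 + K 0 - H (M 0)
      · have hK0 : K 0 ≤ 0 := by
          by_contra! hpos
          have h2 : K 0 ≤ max 0 (H (M 0) - X 0) := (hKlub 0 le_rfl).2 (by
            rintro _ (rfl | ⟨s, hs, rfl⟩)
            · exact le_max_left _ _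
            · obtain rfl : s = 0 := le_antisymm hs.2 hs.1
              exact le_max_right _ _)
          linarith [(le_max_iff.1 h2).resolve_left (by linarith)]
        simp [ENNReal.ofReal_eq_zero.2 hK0]
      · have hsub : {t : ℝ | 0 ≤ t ∧ 0 < X t + K t - H (M t)} ⊆ {0}ᶜ := by
          rintro s hs rfl
          exact h0 hs.2
        refine measure_mono_null hsub ?_
        simp
    rw [lsMeasure, lsMeasureAux_eq FK hKmax, Measure.add_apply, hdir, add_zero]
    refine FK.measure_null_of_forall_le_leftLim fun s hs => ?_
    have hlt : H (M s) - X s < K s := by linarith [hs.2]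
    obtain ⟨u, hsu, hu⟩ := exists_gt_le_of_isLUB hKlub hs.1
      (hHM.continuousWithinAt.sub (hX.1 s hs.1)) hlt
    refine ⟨u, hsu, hu.trans ?_⟩
    rcases hs.1.eq_or_lt with h | h
    · exact le_leftLim_of_nonpos hK hKmax h.ge
    · exact (le_max_iff.1 (le_max_leftLim_of_isLUB hK hKlub h)).resolve_right (not_le.2 hlt)

/-- **Existence part of Theorem 2.2.** -/
theorem tax_reflection_pair_exists
    (δ : ℝ → ℝ) (hδmeas : Measurable δ)
    (hδ01 : ∀ y : ℝ, 0 ≤ y → δ y ∈ Set.Ico (0:ℝ) 1)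
    (hflow : AdmitsUniqueFlow δ)
    (γ ε : ℝ) (hγ : γ ∈ Set.Ico (0:ℝ) 1) (hε : 0 < ε)
    (hconst : ∀ y ∈ Set.Icc (0:ℝ) ε, δ y = γ)
    (X : ℝ → ℝ) (hX : Cadlag X) (hXjumps : NoPosJumps X)
    (xbar : ℝ) (hxbar : max (X 0) 0 ≤ xbar) :
    ∃ V K : ℝ → ℝ, IsTaxReflectionPair δ X xbar V K := by
  have hc0 : 0 ≤ xbar := (le_max_right _ _).trans hxbar
  obtain ⟨z, hz, hz0⟩ := exists_isFlow_le hδmeas hδ01 hflow hγ hε hconst hc0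
  obtain ⟨y, hyc, hymono, hylip, hy0, hypos, hyint⟩ := exists_extended_flow hδmeas hδ01 hz hz0
  have hHmono : Monotone fun m => m - y (m - xbar) := fun a b hab => by
    have := hylip (a - xbar) (b - xbar) (by linarith)
    simp only
    linarith
  have hy1 : 0 < y 1 := hc0.trans_lt (hypos 1 one_pos)
  obtain ⟨K, M, hK, hM, hKmax, hMmax, hKlub, hMlub⟩ :=
    exists_coupled_suprema (H := fun m => m - y (m - xbar)) (X := X) (c := xbar) hHmono
      fun t ht => hasSupersolution_Icc hy1
        (fun m hm => by linarith [hymono (show (1 : ℝ) ≤ m - xbar by linarith)]) hX ht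
  refine ⟨_, K, isTaxReflectionPair_of_coupled (H := fun m => m - y (m - xbar))
    (g := fun m => δ (y (m - xbar)))
    (hδmeas.comp (hyc.measurable.comp (measurable_id.sub_const _))) hHmono (by fun_prop)
    ?_ ?_ (fun m => by simp) ?_ hX hXjumps ((le_max_left _ _).trans hxbar)
    hK hM hKmax hMmax hKlub hMlub⟩
  · intro a b hab
    linarith [hymono (show a - xbar ≤ b - xbar by linarith)]
  · intro m hm
    linarith [hypos (m - xbar) (by linarith)]
  · intro m hm
    rw [intervalIntegral.integral_comp_sub_right (fun s => δ (y s)), sub_self,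
      hyint _ (by linarith)]
    ring

end
end

section
/- Let γ ∈ [0,1) and let X be a càdlàg path with no positive jumps such that X_0 ≤ 0. Then there exists exactly one tax-reflection pair (V⁺, K⁺) for (X, δ, x̄) with the constant tax rate δ ≡ γ and initial maximum level x̄ = 0. (Special case of Theorem 2.2 proved by a contraction/fixed-point argument.) -/
open MeasureTheory Set Filter Function

noncomputable section

/-- Two-sided local boundedness of a path on `[0,∞)`. -/
def LocBdd (Z : ℝ → ℝ) : Prop := ∀ t : ℝ, ∃ C : ℝ, ∀ s ∈ Icc 0 t, |Z s| ≤ C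

/-- Right-continuity of a path on `[0,∞)`. -/
def RightCts (Z : ℝ → ℝ) : Prop := ∀ t : ℝ, 0 ≤ t → ContinuousWithinAt Z (Ici t) t

lemma RightCts.exists_abs_sub_lt {Z : ℝ → ℝ} (hZ : RightCts Z) {t ε : ℝ} (ht : 0 ≤ t)
    (hε : 0 < ε) : ∃ u, t < u ∧ ∀ s, t ≤ s → s < u → |Z s - Z t| < ε := by
  have h := Metric.continuousWithinAt_iff'.1 (hZ t ht) ε hε
  obtain ⟨u, hu, hsub⟩ := mem_nhdsGE_iff_exists_Ico_subset.1 h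
  exact ⟨u, hu, fun s h1 h2 => by simpa [Real.dist_eq] using hsub ⟨h1, h2⟩⟩

lemma MonotoneOn.rightCts_of_forall_exists {G : ℝ → ℝ} (hG : MonotoneOn G (Ici 0))
    (h : ∀ t, 0 ≤ t → ∀ ε, 0 < ε → ∃ u, t < u ∧ G u ≤ G t + ε) : RightCts G := by
  intro t ht
  rw [Metric.continuousWithinAt_iff']
  intro ε hε
  obtain ⟨u, hu, hGu⟩ := h t ht (ε / 2) (by positivity)
  refine mem_nhdsGE_iff_exists_Ico_subset.2 ⟨u, hu, fun s hs => ?_⟩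
  have h0 : 0 ≤ s := ht.trans hs.1
  have h1 := hG (show t ∈ Ici 0 from ht) (show s ∈ Ici 0 from h0) hs.1
  have h2 := hG (show s ∈ Ici 0 from h0) (show u ∈ Ici 0 from ht.trans hu.le) hs.2.le
  simp only [mem_ofPred_eq, Real.dist_eq, abs_lt]
  constructor <;> linarith

lemma monotone_comp_max_zero {G : ℝ → ℝ} (hG : MonotoneOn G (Ici 0)) :
    Monotone fun t => G (max t 0) :=
  fun _ _ h => hG (mem_Ici.2 (le_max_right _ _)) (mem_Ici.2 (le_max_right _ _))
    (max_le_max h le_rfl)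

lemma MonotoneOn.cadlag {G : ℝ → ℝ} (hG : MonotoneOn G (Ici 0)) (hr : RightCts G) :
    Cadlag G := by
  refine ⟨hr, fun t ht => ⟨_, ((monotone_comp_max_zero hG).tendsto_leftLim t).congr' ?_⟩⟩
  filter_upwards [mem_nhdsWithin_of_mem_nhds (Ioi_mem_nhds ht)] with s hs
  rw [max_eq_left (le_of_lt hs)]

lemma Cadlag.add {Y Z : ℝ → ℝ} (hY : Cadlag Y) (hZ : Cadlag Z) :
    Cadlag fun s => Y s + Z s := by
  refine ⟨fun t ht => (hY.1 t ht).add (hZ.1 t ht), fun t ht => ?_⟩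
  obtain ⟨a, ha⟩ := hY.2 t ht
  obtain ⟨b, hb⟩ := hZ.2 t ht
  exact ⟨a + b, ha.add hb⟩

lemma Cadlag.const_mul {Y : ℝ → ℝ} (hY : Cadlag Y) (c : ℝ) : Cadlag fun s => c * Y s := by
  refine ⟨fun t ht => (hY.1 t ht).const_mul c, fun t ht => ?_⟩
  obtain ⟨a, ha⟩ := hY.2 t ht
  exact ⟨c * a, ha.const_mul c⟩

lemma Cadlag.locBdd {Z : ℝ → ℝ} (hZ : Cadlag Z) : LocBdd Z := by
  intro t
  refine (isCompact_Icc (a := (0 : ℝ)) (b := t)).induction_on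
    (p := fun A => ∃ C : ℝ, ∀ s ∈ A, |Z s| ≤ C) ⟨0, by simp⟩ ?_ ?_ ?_
  · rintro A B hAB ⟨C, hC⟩
    exact ⟨C, fun s hs => hC s (hAB hs)⟩
  · rintro A B ⟨C, hC⟩ ⟨D, hD⟩
    refine ⟨max C D, fun s hs => ?_⟩
    rcases hs with hs | hs
    · exact (hC s hs).trans (le_max_left _ _)
    · exact (hD s hs).trans (le_max_right _ _)
  · intro x hx
    have hright : ∀ᶠ s in nhdsWithin x (Ici x), |Z s| < |Z x| + 1 :=
      (hZ.1 x hx.1).abs.eventually_lt_const (lt_add_one _)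
    have hleft : ∃ C : ℝ, ∀ᶠ s in nhdsWithin x (Iio x), 0 ≤ s → |Z s| < C := by
      rcases hx.1.eq_or_lt with h0 | h0
      · refine ⟨0, eventually_nhdsWithin_of_forall fun s hs hs0 => ?_⟩
        have hs' : s < x := hs
        linarith
      · obtain ⟨l, hl⟩ := hZ.2 x h0
        exact ⟨|l| + 1, (hl.abs.eventually_lt_const (lt_add_one _)).mono fun s hs _ => hs⟩
    obtain ⟨C, hC⟩ := hleft
    refine ⟨{s | 0 ≤ s ∧ |Z s| ≤ max (|Z x| + 1) C}, ?_, max (|Z x| + 1) C, fun s hs => hs.2⟩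
    have hall : ∀ᶠ s in nhds x, 0 ≤ s → |Z s| ≤ max (|Z x| + 1) C := by
      rw [← nhdsLT_sup_nhdsGE]
      refine eventually_sup.2 ⟨hC.mono fun s hs h0 => ?_, hright.mono fun s hs _ => ?_⟩
      · exact (hs h0).le.trans (le_max_right _ _)
      · exact hs.le.trans (le_max_left _ _)
    filter_upwards [mem_nhdsWithin_of_mem_nhds hall, self_mem_nhdsWithin] with s hs hs'
    exact ⟨hs'.1, hs hs'.1⟩

lemma MonotoneOn.locBdd {G : ℝ → ℝ} (hG : MonotoneOn G (Ici 0)) : LocBdd G := by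
  refine fun t => ⟨max |G 0| |G t|, fun s hs => ?_⟩
  exact abs_le_max_abs_abs (hG (mem_Ici.2 le_rfl) (mem_Ici.2 hs.1) hs.1)
    (hG (mem_Ici.2 hs.1) (mem_Ici.2 (hs.1.trans hs.2)) hs.2)

lemma LocBdd.add {Y Z : ℝ → ℝ} (hY : LocBdd Y) (hZ : LocBdd Z) :
    LocBdd fun s => Y s + Z s := by
  intro t
  obtain ⟨C, hC⟩ := hY t
  obtain ⟨D, hD⟩ := hZ t
  exact ⟨C + D, fun s hs => (abs_add_le _ _).trans (add_le_add (hC s hs) (hD s hs))⟩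

lemma LocBdd.const_mul {Y : ℝ → ℝ} (hY : LocBdd Y) (c : ℝ) : LocBdd fun s => c * Y s := by
  intro t
  obtain ⟨C, hC⟩ := hY t
  refine ⟨|c| * C, fun s hs => ?_⟩
  rw [abs_mul]
  exact mul_le_mul_of_nonneg_left (hC s hs) (abs_nonneg c)

lemma LocBdd.const_mul_sub {S X : ℝ → ℝ} (hS : LocBdd S) (hX : LocBdd X) (c : ℝ) :
    LocBdd fun s => c * S s - X s := by
  simpa [sub_eq_add_neg] using (hS.const_mul c).add (hX.const_mul (-1))

lemma runSup_le_iff {Y : ℝ → ℝ} (hY : LocBdd Y) {t c : ℝ} (ht : 0 ≤ t) :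
    runSup 0 Y t ≤ c ↔ 0 ≤ c ∧ ∀ s ∈ Icc 0 t, Y s ≤ c := by
  have hb : BddAbove (Y '' Icc 0 t) := by
    obtain ⟨C, hC⟩ := hY t
    refine ⟨C, ?_⟩
    rintro _ ⟨s, hs, rfl⟩
    exact (le_abs_self _).trans (hC s hs)
  rw [runSup, max_le_iff, runSSup,
    csSup_le_iff hb ⟨Y 0, mem_image_of_mem Y ⟨le_rfl, ht⟩⟩, forall_mem_image]

lemma runSup_nonneg (Y : ℝ → ℝ) (t : ℝ) : 0 ≤ runSup 0 Y t := le_max_left _ _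

lemma le_runSup {Y : ℝ → ℝ} (hY : LocBdd Y) {s t : ℝ} (hs : 0 ≤ s) (hst : s ≤ t) :
    Y s ≤ runSup 0 Y t :=
  ((runSup_le_iff hY (hs.trans hst)).1 le_rfl).2 s ⟨hs, hst⟩

lemma runSup_monotoneOn {Y : ℝ → ℝ} (hY : LocBdd Y) : MonotoneOn (runSup 0 Y) (Ici 0) := by
  intro s hs t _ hst
  exact (runSup_le_iff hY hs).2 ⟨runSup_nonneg _ _, fun r hr => le_runSup hY hr.1 (hr.2.trans hst)⟩

lemma runSup_le_add {Y Z : ℝ → ℝ} (hY : LocBdd Y) (hZ : LocBdd Z) {t D : ℝ} (ht : 0 ≤ t)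
    (hD : 0 ≤ D) (h : ∀ s ∈ Icc 0 t, Y s ≤ Z s + D) : runSup 0 Y t ≤ runSup 0 Z t + D := by
  refine (runSup_le_iff hY ht).2 ⟨add_nonneg (runSup_nonneg _ _) hD, fun s hs => ?_⟩
  linarith [h s hs, le_runSup hZ hs.1 hs.2]

lemma runSup_rightCts {Y : ℝ → ℝ} (hY : LocBdd Y) (hr : RightCts Y) :
    RightCts (runSup 0 Y) := by
  refine (runSup_monotoneOn hY).rightCts_of_forall_exists fun t ht ε hε => ?_
  obtain ⟨u, hu, hYu⟩ := hr.exists_abs_sub_lt ht hε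
  refine ⟨(t + u) / 2, by linarith, (runSup_le_iff hY (by linarith)).2
    ⟨add_nonneg (runSup_nonneg _ _) hε.le, fun s hs => ?_⟩⟩
  rcases le_total s t with h | h
  · linarith [le_runSup hY hs.1 h]
  · linarith [(abs_lt.1 (hYu s h (by linarith [hs.2]))).2, le_runSup hY ht le_rfl]

section Measure

variable {G : ℝ → ℝ}

/-- The path frozen at its initial value on the negative half-line, as a Stieltjes function. -/
def stieltjesOf (hG : MonotoneOn G (Ici 0)) (hr : RightCts G) : StieltjesFunction ℝ where
  toFun t := G (max t 0)
  mono' := monotone_comp_max_zero hG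
  right_continuous' x := by
    have hm : Continuous fun y : ℝ => max y 0 := continuous_id.max continuous_const
    exact ContinuousWithinAt.comp (f := fun y : ℝ => max y 0) (hr (max x 0) (le_max_right _ _))
      hm.continuousWithinAt fun y hy =>
        mem_Ici.2 (max_le_max (mem_Ici.1 hy) le_rfl)

lemma stieltjesOf_apply (hG : MonotoneOn G (Ici 0)) (hr : RightCts G) (t : ℝ) :
    stieltjesOf hG hr t = G (max t 0) := rfl

lemma lsMeasure_eq (hG : MonotoneOn G (Ici 0)) (hr : RightCts G) :
    lsMeasure G =
      (stieltjesOf hG hr).measure + ENNReal.ofReal (G 0) • Measure.dirac 0 := by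
  rw [lsMeasure, lsMeasureAux,
    dif_pos ⟨(stieltjesOf hG hr).mono, (stieltjesOf hG hr).right_continuous⟩]
  rfl

lemma lsMeasure_Ioc (hG : MonotoneOn G (Ici 0)) (hr : RightCts G) {a b : ℝ} (ha : 0 ≤ a)
    (hab : a ≤ b) : lsMeasure G (Ioc a b) = ENNReal.ofReal (G b - G a) := by
  rw [lsMeasure_eq hG hr]
  simp [StieltjesFunction.measure_Ioc, stieltjesOf_apply, ha, ha.trans hab, not_lt.2 ha]

lemma lsMeasure_singleton_zero (hG : MonotoneOn G (Ici 0)) (hr : RightCts G) :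
    lsMeasure G {0} = ENNReal.ofReal (G 0) := by
  have h : leftLim (stieltjesOf hG hr) 0 = G 0 := by
    refine leftLim_eq_of_tendsto
      (tendsto_const_nhds.congr' (eventually_nhdsWithin_of_forall fun s hs => ?_))
    rw [stieltjesOf_apply, max_eq_right (le_of_lt hs)]
  rw [lsMeasure_eq hG hr]
  simp [StieltjesFunction.measure_singleton, h, stieltjesOf_apply]

lemma lsMeasure_singleton_of_pos (hG : MonotoneOn G (Ici 0)) (hr : RightCts G) {s : ℝ}
    (hs : 0 < s) :
    lsMeasure G {s} = ENNReal.ofReal (G s - leftLim (stieltjesOf hG hr) s) := by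
  rw [lsMeasure_eq hG hr]
  simp [StieltjesFunction.measure_singleton, stieltjesOf_apply, hs.le, hs.ne]

lemma RightCts.le_apply_csInf (hr : RightCts G) {A : Set ℝ} {c : ℝ} (hne : A.Nonempty)
    (h0 : ∀ s ∈ A, 0 ≤ s) (hc : ∀ s ∈ A, c ≤ G s) : c ≤ G (sInf A) := by
  by_contra! h
  obtain ⟨u, hu, hGu⟩ := hr.exists_abs_sub_lt (le_csInf hne h0) (sub_pos.2 h)
  obtain ⟨a, ha, hau⟩ := exists_lt_of_csInf_lt hne hu
  linarith [(abs_lt.1 (hGu a (csInf_le ⟨0, h0⟩ ha) hau)).2, hc a ha]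

/-- Uniqueness in the Skorokhod problem: the regulator is the running supremum of `-Z`. -/
lemma eq_runSup_neg_of_reflection {V K Z : ℝ → ℝ} (hK : MonotoneOn K (Ici 0))
    (hr : RightCts K) (hZ : LocBdd fun s => -Z s) (hV0 : ∀ t, 0 ≤ t → 0 ≤ V t)
    (hV : ∀ t, 0 ≤ t → V t = Z t + K t) (hK0 : 0 ≤ K 0)
    (hcomp : lsMeasure K {t : ℝ | 0 ≤ t ∧ 0 < V t} = 0) {t : ℝ} (ht : 0 ≤ t) :
    K t = runSup 0 (fun s => -Z s) t := by
  have hle : runSup 0 (fun s => -Z s) t ≤ K t := by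
    refine (runSup_le_iff hZ ht).2 ⟨hK0.trans (hK (mem_Ici.2 le_rfl) ht ht), fun s hs => ?_⟩
    linarith [hV s hs.1, hV0 s hs.1, hK (mem_Ici.2 hs.1) ht hs.2]
  refine le_antisymm ?_ hle
  by_contra! hlt
  set c := runSup 0 (fun s => -Z s) t with hc
  have hc0 : 0 ≤ c := runSup_nonneg _ _
  have hpos : ∀ s ∈ Icc 0 t, c < K s → 0 < V s := fun s hs h => by
    linarith [hV s hs.1, le_runSup hZ hs.1 hs.2]
  let A : Set ℝ := {s | s ∈ Icc 0 t ∧ c < K s}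
  have htA : t ∈ A := ⟨⟨ht, le_rfl⟩, hlt⟩
  have hA0 : ∀ s ∈ A, 0 ≤ s := fun s hs => hs.1.1
  set τ := sInf A with hτ
  have hτ0 : 0 ≤ τ := le_csInf ⟨t, htA⟩ hA0
  have hτt : τ ≤ t := csInf_le ⟨0, hA0⟩ htA
  have hafter : ∀ s, τ < s → s ≤ t → c < K s := by
    intro s h1 h2
    obtain ⟨a, ha, has⟩ := exists_lt_of_csInf_lt ⟨t, htA⟩ h1
    exact ha.2.trans_le (hK (hA0 a ha) (mem_Ici.2 (hτ0.trans h1.le)) has.le)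
  have hsub : Ioc τ t ⊆ {t : ℝ | 0 ≤ t ∧ 0 < V t} := fun s hs =>
    ⟨hτ0.trans hs.1.le, hpos s ⟨hτ0.trans hs.1.le, hs.2⟩ (hafter s hs.1 hs.2)⟩
  have hIoc : lsMeasure K (Ioc τ t) = 0 := measure_mono_null hsub hcomp
  rw [lsMeasure_Ioc hK hr hτ0 hτt, ENNReal.ofReal_eq_zero] at hIoc
  have hKτ : c < K τ := by linarith
  have hsing : lsMeasure K {τ} = 0 := measure_mono_null (fun s hs => by
    rw [mem_singleton_iff.1 hs]
    exact ⟨hτ0, hpos τ ⟨hτ0, hτt⟩ hKτ⟩) hcomp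
  rcases hτ0.eq_or_lt with h0 | h0
  · rw [← h0, lsMeasure_singleton_zero hK hr, ENNReal.ofReal_eq_zero, h0] at hsing
    linarith
  · rw [lsMeasure_singleton_of_pos hK hr h0, ENNReal.ofReal_eq_zero] at hsing
    have hlim : leftLim (stieltjesOf hK hr) τ ≤ c := by
      refine le_of_tendsto ((stieltjesOf hK hr).mono.tendsto_leftLim τ) ?_
      filter_upwards [mem_nhdsWithin_of_mem_nhds (Ioi_mem_nhds h0), self_mem_nhdsWithin]
        with s hs0 hsτ
      rw [stieltjesOf_apply, max_eq_left (le_of_lt hs0)]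
      by_contra! hcs
      have hsτ' : s < τ := hsτ
      exact absurd (csInf_le ⟨0, hA0⟩ (show s ∈ A from
        ⟨⟨le_of_lt hs0, hsτ'.le.trans hτt⟩, hcs⟩)) (not_le.2 hsτ')
    linarith

/-- The regulator `runSup 0 (-Z)` has no atom where the reflected path is positive. -/
lemma lsMeasure_runSup_neg_singleton {Z : ℝ → ℝ} (hZ : LocBdd fun s => -Z s)
    (hr : RightCts (runSup 0 fun s => -Z s)) {s : ℝ} (hs : 0 ≤ s)
    (hpos : 0 < Z s + runSup 0 (fun r => -Z r) s) :
    lsMeasure (runSup 0 fun r => -Z r) {s} = 0 := by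
  have hK := runSup_monotoneOn hZ
  set K := runSup 0 fun r => -Z r with hKdef
  rcases hs.eq_or_lt with h0 | h0
  · subst h0
    rw [lsMeasure_singleton_zero hK hr, ENNReal.ofReal_eq_zero]
    by_contra! hK0
    have : K 0 ≤ max 0 (-Z 0) := by
      refine (runSup_le_iff hZ le_rfl).2 ⟨le_max_left _ _, fun r hr => ?_⟩
      rw [le_antisymm hr.2 hr.1]
      exact le_max_right _ _
    rcases le_max_iff.1 this with h | h <;> linarith
  · rw [lsMeasure_singleton_of_pos hK hr h0, ENNReal.ofReal_eq_zero]
    set l := leftLim (stieltjesOf hK hr) s with hl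
    have hbefore : ∀ r, 0 ≤ r → r < s → K r ≤ l := fun r hr0 hrs => by
      have := (stieltjesOf hK hr).mono.le_leftLim hrs
      rwa [stieltjesOf_apply, max_eq_left hr0] at this
    have : K s ≤ max l (-Z s) := by
      refine (runSup_le_iff hZ hs).2
        ⟨((runSup_nonneg _ _).trans (hbefore 0 le_rfl h0)).trans (le_max_left _ _), fun r hr => ?_⟩
      rcases hr.2.eq_or_lt with h | h
      · rw [h]
        exact le_max_right _ _
      · exact ((le_runSup hZ hr.1 le_rfl).trans (hbefore r hr.1 h)).trans (le_max_left _ _)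
    rcases le_max_iff.1 this with h | h <;> linarith

/-- Complementarity of the Skorokhod regulator. -/
lemma lsMeasure_runSup_neg_pos {Z : ℝ → ℝ} (hZ : LocBdd fun s => -Z s)
    (hZr : RightCts fun s => -Z s) :
    lsMeasure (runSup 0 fun s => -Z s)
      {t : ℝ | 0 ≤ t ∧ 0 < Z t + runSup 0 (fun s => -Z s) t} = 0 := by
  have hr := runSup_rightCts hZ hZr
  have hK := runSup_monotoneOn hZ
  have hsing := fun s => lsMeasure_runSup_neg_singleton (s := s) hZ hr
  have hnonneg := runSup_nonneg (fun s => -Z s)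
  have hle := fun s c h0 => runSup_le_iff (t := s) (c := c) hZ h0
  have hle' := fun s (hs : (0 : ℝ) ≤ s) => le_runSup hZ hs le_rfl
  set K := runSup 0 fun s => -Z s with hKdef
  let A : ℚ → Set ℝ := fun q => {s | s ∈ Icc (0 : ℝ) q ∧ K s = K q}
  have hsub : {t : ℝ | 0 ≤ t ∧ 0 < Z t + K t} ⊆ ⋃ q : ℚ, A q ∩ {t | 0 ≤ t ∧ 0 < Z t + K t} := by
    rintro s ⟨hs, hpos⟩
    obtain ⟨u, hu, hZu⟩ := hZr.exists_abs_sub_lt hs hpos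
    obtain ⟨q, hsq, hqu⟩ := exists_rat_btwn hu
    refine mem_iUnion.2 ⟨q, ⟨⟨hs, hsq.le⟩, le_antisymm ?_ ?_⟩, hs, hpos⟩
    · exact hK (mem_Ici.2 hs) (mem_Ici.2 (hs.trans hsq.le)) hsq.le
    · refine (hle q _ (hs.trans hsq.le)).2 ⟨hnonneg s, fun r hr => ?_⟩
      rcases le_total r s with h | h
      · exact le_runSup hZ hr.1 h
      · linarith [(abs_lt.1 (hZu r h (hr.2.trans_lt hqu))).2]
  refine measure_mono_null hsub (measure_iUnion_null fun q => ?_)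
  rcases (A q).eq_empty_or_nonempty with he | hne
  · rw [he, empty_inter, measure_empty]
  have hA0 : ∀ s ∈ A q, 0 ≤ s := fun s hs => hs.1.1
  have hτ0 : 0 ≤ sInf (A q) := le_csInf hne hA0
  have hτq : sInf (A q) ≤ q := (csInf_le ⟨0, hA0⟩ hne.some_mem).trans hne.some_mem.1.2
  have hKτ : (K q : ℝ) ≤ K (sInf (A q)) := hr.le_apply_csInf hne hA0 fun s hs => hs.2.ge
  have hcover : A q ∩ {t | 0 ≤ t ∧ 0 < Z t + K t} ⊆
      Ioc (sInf (A q)) q ∪ ({sInf (A q)} ∩ {t | 0 ≤ t ∧ 0 < Z t + K t}) := by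
    rintro s ⟨hs, hs'⟩
    rcases (csInf_le ⟨0, hA0⟩ hs).eq_or_lt with h | h
    · exact Or.inr ⟨h.symm, hs'⟩
    · exact Or.inl ⟨h, hs.1.2⟩
  refine measure_mono_null hcover (measure_union_null ?_ ?_)
  · rw [lsMeasure_Ioc hK hr hτ0 hτq, ENNReal.ofReal_eq_zero]
    linarith
  · by_cases hp : 0 < Z (sInf (A q)) + K (sInf (A q))
    · exact measure_mono_null inter_subset_left (hsing _ hτ0 hp)
    · convert measure_empty (μ := lsMeasure K)
      ext s
      simp only [mem_inter_iff, mem_singleton_iff, mem_ofPred_eq, mem_empty_iff_false, iff_false]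
      rintro ⟨rfl, -, h⟩
      exact hp h

lemma setIntegral_const_lsMeasure (hG : MonotoneOn G (Ici 0)) (hr : RightCts G) (c : ℝ) {t : ℝ}
    (ht : 0 ≤ t) : ∫ _ in Ioc (0 : ℝ) t, c ∂(lsMeasure G) = c * (G t - G 0) := by
  rw [setIntegral_const, measureReal_def, lsMeasure_Ioc hG hr le_rfl ht, ENNReal.toReal_ofReal
    (sub_nonneg.2 (hG (mem_Ici.2 le_rfl) ht ht)), smul_eq_mul, mul_comm]

end Measure

section FixedPoint

variable {γ : ℝ} {X : ℝ → ℝ}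

/-- The map whose fixed points are the taxed running suprema: reflect `X - γ S` at `0` and take
the running supremum of `X` plus the resulting regulator. -/
def taxMap (γ : ℝ) (X S : ℝ → ℝ) : ℝ → ℝ :=
  runSup 0 fun s => X s + runSup 0 (fun r => γ * S r - X r) s

lemma taxMap_locBdd (hX : LocBdd X) {S : ℝ → ℝ} (hS : LocBdd S) :
    LocBdd fun s => X s + runSup 0 (fun r => γ * S r - X r) s :=
  hX.add (runSup_monotoneOn (hS.const_mul_sub hX γ)).locBdd

lemma taxMap_le_add (hγ : 0 ≤ γ) (hX : LocBdd X) {S T : ℝ → ℝ} (hS : LocBdd S) (hT : LocBdd T)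
    {t D : ℝ} (ht : 0 ≤ t) (hD : 0 ≤ D) (h : ∀ s ∈ Icc 0 t, S s ≤ T s + D) :
    taxMap γ X S t ≤ taxMap γ X T t + γ * D := by
  have hγD := mul_nonneg hγ hD
  refine runSup_le_add (taxMap_locBdd hX hS) (taxMap_locBdd hX hT) ht hγD fun s hs => ?_
  have := runSup_le_add (hS.const_mul_sub hX γ) (hT.const_mul_sub hX γ) hs.1 hγD fun r hr => by
    linarith [mul_le_mul_of_nonneg_left (h r ⟨hr.1, hr.2.trans hs.2⟩) hγ]
  linarith

lemma taxMap_mono (hγ : 0 ≤ γ) (hX : LocBdd X) {S T : ℝ → ℝ} (hS : LocBdd S) (hT : LocBdd T)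
    (h : ∀ s, 0 ≤ s → S s ≤ T s) {t : ℝ} (ht : 0 ≤ t) : taxMap γ X S t ≤ taxMap γ X T t := by
  simpa using taxMap_le_add hγ hX hS hT ht le_rfl fun s hs => by simpa using h s hs.1

lemma le_of_taxMap_fixed (hγ : γ ∈ Ico (0 : ℝ) 1) (hX : LocBdd X) {S T : ℝ → ℝ} (hS : LocBdd S)
    (hT : LocBdd T) (hfS : ∀ t, 0 ≤ t → S t = taxMap γ X S t)
    (hfT : ∀ t, 0 ≤ t → T t = taxMap γ X T t) {t : ℝ} (ht : 0 ≤ t) : S t ≤ T t := by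
  have hb : LocBdd fun s => S s - T s := by simpa using hS.const_mul_sub hT 1
  have hD := runSup_nonneg (fun s => S s - T s) t
  have hle := fun s (hs : s ∈ Icc 0 t) => le_runSup hb hs.1 hs.2
  set D := runSup 0 (fun s => S s - T s) t with hDdef
  have hcontr : D ≤ γ * D := by
    refine (runSup_le_iff hb ht).2 ⟨mul_nonneg hγ.1 hD, fun s hs => ?_⟩
    have := taxMap_le_add hγ.1 hX hS hT hs.1 hD fun r hr => by
      linarith [hle r ⟨hr.1, hr.2.trans hs.2⟩]
    linarith [hfS s hs.1, hfT s hs.1]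
  have hD0 : D ≤ 0 := by nlinarith [hγ.2]
  linarith [hle t ⟨ht, le_rfl⟩]

lemma exists_taxMap_fixed (hγ : γ ∈ Ico (0 : ℝ) 1) (hX : LocBdd X) :
    ∃ S : ℝ → ℝ, MonotoneOn S (Ici 0) ∧ ∀ t, 0 ≤ t → S t = taxMap γ X S t := by
  let 𝒞 : Set (ℝ → ℝ) := {S | MonotoneOn S (Ici 0) ∧ ∀ t, 0 ≤ t → taxMap γ X S t ≤ S t}
  have hγ1 : 0 < 1 - γ := sub_pos.2 hγ.2
  have hXabs : LocBdd fun s => |X s| := by simpa [LocBdd] using hX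
  have hne : 𝒞.Nonempty := by
    have hM := runSup_monotoneOn hXabs
    have hM0 := runSup_nonneg fun s => |X s|
    have hXM := fun s r (hs : 0 ≤ s) (hsr : s ≤ r) => le_runSup hXabs hs hsr
    set M := runSup 0 fun s => |X s| with hMdef
    have hB : MonotoneOn (fun s => 2 / (1 - γ) * M s) (Ici 0) := fun s hs t ht hst =>
      mul_le_mul_of_nonneg_left (hM hs ht hst) (by positivity)
    have hB0 : ∀ s, 0 ≤ 2 / (1 - γ) * M s := fun s => mul_nonneg (by positivity) (hM0 s)
    refine ⟨_, hB, fun t ht => (runSup_le_iff (taxMap_locBdd hX hB.locBdd) ht).2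
      ⟨hB0 t, fun s hs => ?_⟩⟩
    have hreg : runSup 0 (fun r => γ * (2 / (1 - γ) * M r) - X r) s ≤
        γ * (2 / (1 - γ) * M s) + M s := by
      refine (runSup_le_iff (hB.locBdd.const_mul_sub hX γ) hs.1).2
        ⟨add_nonneg (mul_nonneg hγ.1 (hB0 s)) (hM0 s), fun r hr => ?_⟩
      have h1 := mul_le_mul_of_nonneg_left (hB (mem_Ici.2 hr.1) (mem_Ici.2 hs.1) hr.2) hγ.1
      have h2 := hXM r s hr.1 hr.2
      simp only at h1
      linarith [neg_abs_le (X r)]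
    have h3 := hXM s s hs.1 le_rfl
    have h4 : γ * (2 / (1 - γ) * M s) + 2 * M s = 2 / (1 - γ) * M s := by
      field_simp
      ring
    have h5 := hB (mem_Ici.2 hs.1) (mem_Ici.2 ht) hs.2
    simp only at h5
    linarith [le_abs_self (X s)]
  have hbdd : ∀ t, 0 ≤ t → BddBelow ((fun S : ℝ → ℝ => S t) '' 𝒞) := fun t ht => ⟨0, by
    rintro _ ⟨S, hS, rfl⟩
    exact (runSup_nonneg _ _).trans (hS.2 t ht)⟩
  let I : ℝ → ℝ := fun t => sInf ((fun S : ℝ → ℝ => S t) '' 𝒞)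
  have hI_le : ∀ S ∈ 𝒞, ∀ t, 0 ≤ t → I t ≤ S t := fun S hS t ht =>
    csInf_le (hbdd t ht) (mem_image_of_mem _ hS)
  have hle_I : ∀ t c, (∀ S ∈ 𝒞, c ≤ S t) → c ≤ I t := fun t c h =>
    le_csInf (hne.image _) (forall_mem_image.2 h)
  have hI : MonotoneOn I (Ici 0) := fun s hs t ht hst =>
    hle_I t _ fun S hS => (hI_le S hS s hs).trans (hS.1 hs ht hst)
  have hpre : ∀ t, 0 ≤ t → taxMap γ X I t ≤ I t := fun t ht => hle_I t _ fun S hS =>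
    (taxMap_mono hγ.1 hX hI.locBdd hS.1.locBdd (hI_le S hS) ht).trans (hS.2 t ht)
  have hmono : MonotoneOn (taxMap γ X I) (Ici 0) := runSup_monotoneOn (taxMap_locBdd hX hI.locBdd)
  exact ⟨I, hI, fun t ht => le_antisymm (hI_le _ ⟨hmono, fun s hs =>
    taxMap_mono hγ.1 hX hmono.locBdd hI.locBdd hpre hs⟩ t ht) (hpre t ht)⟩

lemma taxMap_fixed_rightCts (hγ : γ ∈ Ico (0 : ℝ) 1) (hX : LocBdd X) (hXr : RightCts X)
    {S : ℝ → ℝ} (hS : MonotoneOn S (Ici 0)) (hfix : ∀ t, 0 ≤ t → S t = taxMap γ X S t) :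
    RightCts S := by
  have hγ1 : 0 < 1 - γ := sub_pos.2 hγ.2
  have hZ := hS.locBdd.const_mul_sub hX γ
  have hY := taxMap_locBdd (γ := γ) hX hS.locBdd
  refine hS.rightCts_of_forall_exists fun t ht ε hε => ?_
  obtain ⟨v, hv, hXv⟩ := hXr.exists_abs_sub_lt ht (ε := (1 - γ) * ε / 2) (by positivity)
  set η := (1 - γ) * ε / 2 with hη
  have hη0 : 0 < η := by positivity
  set u := (t + v) / 2 with hu
  have htu : t < u := by linarith
  have hu0 : 0 ≤ u := by linarith
  have hSu : 0 ≤ S u - S t := sub_nonneg.2 (hS (mem_Ici.2 ht) (mem_Ici.2 hu0) htu.le)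
  have hγS := mul_nonneg hγ.1 hSu
  have hfar : ∀ s ∈ Icc t u, runSup 0 (fun r => γ * S r - X r) s ≤
      runSup 0 (fun r => γ * S r - X r) t + (γ * (S u - S t) + η) := by
    intro s hs
    refine (runSup_le_iff hZ (ht.trans hs.1)).2
      ⟨by linarith [runSup_nonneg (fun r => γ * S r - X r) t], fun r hr => ?_⟩
    rcases le_total r t with h | h
    · linarith [le_runSup hZ hr.1 h]
    · have h1 := le_runSup hZ ht le_rfl
      have h2 := (abs_lt.1 (hXv r h (by linarith [hr.2, hs.2]))).1
      have h3 := mul_le_mul_of_nonneg_left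
        (hS (mem_Ici.2 hr.1) (mem_Ici.2 hu0) (hr.2.trans hs.2)) hγ.1
      linarith
  have hbound : S u ≤ S t + (γ * (S u - S t) + 2 * η) := by
    conv_lhs => rw [hfix u hu0]
    have hSt := hfix t ht
    have hSt0 : 0 ≤ S t := hSt ▸ runSup_nonneg _ _
    refine (runSup_le_iff hY hu0).2 ⟨by linarith, fun s hs => ?_⟩
    rcases le_total s t with h | h
    · have := le_runSup hY hs.1 h
      rw [taxMap] at hSt
      linarith
    · have h1 := hfar s ⟨h, hs.2⟩
      have h2 := (abs_lt.1 (hXv s h (by linarith [hs.2]))).2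
      have h3 := le_runSup hY ht le_rfl
      rw [taxMap] at hSt
      linarith
  refine ⟨u, htu, ?_⟩
  have : (1 - γ) * (S u - S t) ≤ (1 - γ) * ε := by linarith
  linarith [le_of_mul_le_mul_left this hγ1]

end FixedPoint

/-- A pair with constant rate is determined by a fixed point of `taxMap`. -/
lemma IsTaxReflectionPair.eq_of_const {γ : ℝ} {X V K : ℝ → ℝ} (hX : Cadlag X) (hX0 : X 0 ≤ 0)
    (h : IsTaxReflectionPair (fun _ => γ) X 0 V K) :
    ∃ S : ℝ → ℝ, LocBdd S ∧ ∀ t, 0 ≤ t → S t = taxMap γ X S t ∧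
      K t = runSup 0 (fun s => γ * S s - X s) t ∧ V t = X t + K t - γ * S t := by
  obtain ⟨-, hKc, hV0, hK, hVeq, hcomp⟩ := h
  have hYc := hX.add hKc
  have hY := hYc.locBdd
  have hS := runSup_monotoneOn hY
  have hSr := runSup_rightCts hY hYc.1
  set S := runSup 0 fun s => X s + K s with hSdef
  have hV : ∀ t, 0 ≤ t → V t = X t + K t - γ * (S t - S 0) := fun t ht => by
    rw [hVeq t ht, setIntegral_const_lsMeasure hS hSr γ ht]
  have hK0 : 0 ≤ K 0 := by
    have h1 := hV 0 le_rfl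
    rw [sub_self, mul_zero] at h1
    linarith [hV0 0 le_rfl]
  have hZ : LocBdd fun s => -(X s - γ * (S s - S 0)) := by
    have h1 : MonotoneOn (fun s => S s - S 0) (Ici 0) := fun s hs t ht hst =>
      sub_le_sub_right (hS hs ht hst) _
    simpa using h1.locBdd.const_mul_sub hX.locBdd γ
  have hKeq : ∀ t, 0 ≤ t → K t = runSup 0 (fun s => -(X s - γ * (S s - S 0))) t := fun t ht =>
    eq_runSup_neg_of_reflection hK hKc.1 hZ hV0 (fun s hs => by rw [hV s hs]; ring) hK0 hcomp ht
  have hKX : K 0 ≤ -X 0 := by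
    rw [hKeq 0 le_rfl]
    refine (runSup_le_iff hZ le_rfl).2 ⟨by linarith, fun s hs => ?_⟩
    rw [le_antisymm hs.2 hs.1]
    simp
  have hS0 : S 0 = 0 := by
    refine le_antisymm ((runSup_le_iff hY le_rfl).2 ⟨le_rfl, fun s hs => ?_⟩) (runSup_nonneg _ _)
    rw [le_antisymm hs.2 hs.1]
    linarith
  have hKeq' : ∀ t, 0 ≤ t → K t = runSup 0 (fun s => γ * S s - X s) t := by
    simpa [hS0] using hKeq
  have hb : LocBdd S := hS.locBdd
  refine ⟨S, hb, fun t ht => ⟨?_, hKeq' t ht, by rw [hV t ht, hS0, sub_zero]⟩⟩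
  have hY' := taxMap_locBdd (γ := γ) hX.locBdd hb
  apply le_antisymm
  · simpa [taxMap] using runSup_le_add hY hY' ht le_rfl fun s hs => by rw [hKeq' s hs.1, add_zero]
  · simpa [taxMap] using runSup_le_add hY' hY ht le_rfl fun s hs => by rw [hKeq' s hs.1, add_zero]

lemma exists_isTaxReflectionPair_const {γ : ℝ} (hγ : γ ∈ Ico (0 : ℝ) 1) {X : ℝ → ℝ}
    (hX : Cadlag X) (hX0 : X 0 ≤ 0) :
    ∃ V K : ℝ → ℝ, IsTaxReflectionPair (fun _ => γ) X 0 V K := by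
  obtain ⟨S, hS, hfix⟩ := exists_taxMap_fixed hγ hX.locBdd
  have hSr := taxMap_fixed_rightCts hγ hX.locBdd hX.1 hS hfix
  have hSc := hS.cadlag hSr
  have hZc : Cadlag fun s => -(X s - γ * S s) := by
    simpa [sub_eq_add_neg] using (hSc.const_mul γ).add (hX.const_mul (-1))
  have hZ := hZc.locBdd
  have hK := runSup_monotoneOn hZ
  have hKc := hK.cadlag (runSup_rightCts hZ hZc.1)
  have hcomp := lsMeasure_runSup_neg_pos hZ hZc.1
  have hle := fun s (hs : (0 : ℝ) ≤ s) => le_runSup hZ hs le_rfl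
  have hfix' : ∀ t, 0 ≤ t →
      S t = runSup 0 (fun s => X s + runSup 0 (fun s => -(X s - γ * S s)) s) t := by
    simpa [taxMap] using hfix
  have hS0nonneg : 0 ≤ S 0 := (hfix' 0 le_rfl).symm ▸ runSup_nonneg _ _
  have hKX : runSup 0 (fun s => -(X s - γ * S s)) 0 ≤ γ * S 0 - X 0 := by
    refine (runSup_le_iff hZ le_rfl).2 ⟨by linarith [mul_nonneg hγ.1 hS0nonneg], fun s hs => ?_⟩
    rw [le_antisymm hs.2 hs.1]
    linarith
  set K := runSup 0 fun s => -(X s - γ * S s) with hKdef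
  have hYc := hX.add hKc
  have hS0 : S 0 = 0 := by
    have h1 : S 0 ≤ γ * S 0 := by
      conv_lhs => rw [hfix' 0 le_rfl]
      refine (runSup_le_iff hYc.locBdd le_rfl).2 ⟨mul_nonneg hγ.1 hS0nonneg, fun s hs => ?_⟩
      rw [le_antisymm hs.2 hs.1]
      linarith
    nlinarith [hγ.2]
  refine ⟨fun t => (X t - γ * S t) + K t, K, ?_, hKc, fun t ht => ?_, hK, fun t ht => ?_, hcomp⟩
  · simpa using (hZc.const_mul (-1)).add hKc
  · linarith [hle t ht]
  · rw [setIntegral_const_lsMeasure (runSup_monotoneOn hYc.locBdd)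
      (runSup_rightCts hYc.locBdd hYc.1) γ ht, ← hfix' t ht, ← hfix' 0 le_rfl, hS0]
    ring

/-- **Special case of Theorem 2.2 (constant tax rate, initial maximum level 0).** -/
theorem tax_reflection_pair_const_rate_exists_unique
    (γ : ℝ) (hγ : γ ∈ Set.Ico (0:ℝ) 1)
    (X : ℝ → ℝ) (hX : Cadlag X) (hXjumps : NoPosJumps X) (hX0 : X 0 ≤ 0) :
    (∃ V K : ℝ → ℝ, IsTaxReflectionPair (fun _ => γ) X 0 V K) ∧
    ∀ V K W L : ℝ → ℝ,
      IsTaxReflectionPair (fun _ => γ) X 0 V K →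
      IsTaxReflectionPair (fun _ => γ) X 0 W L →
      ∀ t : ℝ, 0 ≤ t → V t = W t ∧ K t = L t := by
  refine ⟨exists_isTaxReflectionPair_const hγ hX hX0, fun V K W L hVK hWL t ht => ?_⟩
  obtain ⟨S, hS, hSK⟩ := hVK.eq_of_const hX hX0
  obtain ⟨T, hT, hTL⟩ := hWL.eq_of_const hX hX0
  have hST : ∀ s, 0 ≤ s → S s = T s := fun s hs => le_antisymm
    (le_of_taxMap_fixed hγ hX.locBdd hS hT (fun r hr => (hSK r hr).1) (fun r hr => (hTL r hr).1) hs)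
    (le_of_taxMap_fixed hγ hX.locBdd hT hS (fun r hr => (hTL r hr).1) (fun r hr => (hSK r hr).1) hs)
  have hKL : K t = L t := by
    have hbS := hS.const_mul_sub hX.locBdd γ
    have hbT := hT.const_mul_sub hX.locBdd γ
    rw [(hSK t ht).2.1, (hTL t ht).2.1]
    apply le_antisymm
    · simpa using runSup_le_add hbS hbT ht le_rfl fun s hs => by rw [hST s hs.1, add_zero]
    · simpa using runSup_le_add hbT hbS ht le_rfl fun s hs => by rw [hST s hs.1, add_zero]
  exact ⟨by rw [(hSK t ht).2.2, (hTL t ht).2.2, hKL, hST t ht], hKL⟩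


end
end

section
/- Let γ ∈ [0,1) and let X : [0,∞) → ℝ be a càdlàg path with X_0 ≤ 0. Then there exists exactly one càdlàg path K : [0,∞) → ℝ such that for all t ≥ 0, K_t = max(0, −inf_{0≤s≤t}(X_s − γ·sup_{0≤u≤s}(X_u + K_u))). (Unique solvability of the fixed-point equation K = Ψ(X − γ S(X+K)).) -/
open MeasureTheory Set Filter Function

noncomputable section

/-- A path that is bounded on compact subintervals of `[0,∞)` and right-continuous there. -/
structure LocBddRightCont (Z : ℝ → ℝ) : Prop where
  bdd : ∀ t : ℝ, ∃ M : ℝ, ∀ s ∈ Set.Icc 0 t, |Z s| ≤ M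
  rightCont : ∀ t : ℝ, 0 ≤ t → ContinuousWithinAt Z (Set.Ici t) t

lemma Cadlag.exists_abs_le {Z : ℝ → ℝ} (hZ : Cadlag Z) (t : ℝ) :
    ∃ M : ℝ, ∀ s ∈ Set.Icc 0 t, |Z s| ≤ M := by
  refine isCompact_Icc.induction_on (p := fun A => ∃ M : ℝ, ∀ s ∈ A, |Z s| ≤ M)
    ⟨0, by simp⟩ (fun A B hAB ⟨M, hM⟩ => ⟨M, fun s hs => hM s (hAB hs)⟩)
    (fun A B ⟨M, hM⟩ ⟨N, hN⟩ => ⟨max M N, ?_⟩) fun x hx => ?_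
  · rintro s (hs | hs)
    · exact (hM s hs).trans (le_max_left _ _)
    · exact (hN s hs).trans (le_max_right _ _)
  have bound : ∀ {F : Filter ℝ} {l : ℝ}, Tendsto Z F (nhds l) → ∀ᶠ s in F, |Z s| ≤ |l| + 1 :=
    fun h => (h.abs.eventually (gt_mem_nhds (lt_add_one _))).mono fun _ hs => hs.le
  have hr := bound (hZ.1 x hx.1)
  rcases hx.1.eq_or_lt with h0 | h0
  · subst h0
    exact ⟨_, nhdsWithin_mono _ Set.Icc_subset_Ici_self hr, ⟨_, fun s hs => hs⟩⟩
  · obtain ⟨l, hl⟩ := hZ.2 x h0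
    have hl' := bound hl
    refine ⟨{s | |Z s| ≤ max (|l| + 1) (|Z x| + 1)}, mem_nhdsWithin_of_mem_nhds ?_,
      ⟨_, fun s hs => hs⟩⟩
    have : ∀ᶠ s in nhdsWithin x (Set.Iio x) ⊔ nhdsWithin x (Set.Ici x),
        |Z s| ≤ max (|l| + 1) (|Z x| + 1) :=
      eventually_sup.2 ⟨hl'.mono fun s hs => hs.trans (le_max_left _ _),
        hr.mono fun s hs => hs.trans (le_max_right _ _)⟩
    rwa [← nhdsWithin_union, Set.Iio_union_Ici, nhdsWithin_univ] at this

lemma Cadlag.locBddRightCont {Z : ℝ → ℝ} (hZ : Cadlag Z) : LocBddRightCont Z :=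
  ⟨hZ.exists_abs_le, hZ.1⟩

namespace LocBddRightCont

variable {Y Z : ℝ → ℝ}

lemma add (hY : LocBddRightCont Y) (hZ : LocBddRightCont Z) :
    LocBddRightCont fun s => Y s + Z s where
  bdd t := by
    obtain ⟨M, hM⟩ := hY.bdd t
    obtain ⟨N, hN⟩ := hZ.bdd t
    exact ⟨M + N, fun s hs => (abs_add_le _ _).trans (add_le_add (hM s hs) (hN s hs))⟩
  rightCont t ht := (hY.rightCont t ht).add (hZ.rightCont t ht)

lemma const_mul (c : ℝ) (hZ : LocBddRightCont Z) : LocBddRightCont fun s => c * Z s where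
  bdd t := by
    obtain ⟨M, hM⟩ := hZ.bdd t
    refine ⟨|c| * M, fun s hs => ?_⟩
    rw [abs_mul]
    exact mul_le_mul_of_nonneg_left (hM s hs) (abs_nonneg c)
  rightCont t ht := (hZ.rightCont t ht).const_mul c

lemma neg (hZ : LocBddRightCont Z) : LocBddRightCont fun s => -Z s where
  bdd t := by simpa only [abs_neg] using hZ.bdd t
  rightCont t ht := (hZ.rightCont t ht).neg

lemma sub (hY : LocBddRightCont Y) (hZ : LocBddRightCont Z) :
    LocBddRightCont fun s => Y s - Z s := by
  simpa only [sub_eq_add_neg] using hY.add hZ.neg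

lemma zero : LocBddRightCont fun _ => 0 where
  bdd _ := ⟨0, fun _ _ => by simp⟩
  rightCont _ _ := continuousWithinAt_const

lemma le_runSSup (hZ : LocBddRightCont Z) {s t : ℝ} (hs : s ∈ Set.Icc 0 t) :
    Z s ≤ runSSup Z t := by
  obtain ⟨M, hM⟩ := hZ.bdd t
  refine le_csSup ⟨M, ?_⟩ (Set.mem_image_of_mem Z hs)
  rintro _ ⟨u, hu, rfl⟩
  exact (le_abs_self _).trans (hM u hu)

end LocBddRightCont

lemma runSSup_le {Z : ℝ → ℝ} {t M : ℝ} (ht : 0 ≤ t) (h : ∀ s ∈ Set.Icc 0 t, Z s ≤ M) :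
    runSSup Z t ≤ M := by
  refine csSup_le ((Set.nonempty_Icc.2 ht).image Z) ?_
  rintro _ ⟨u, hu, rfl⟩
  exact h u hu

namespace LocBddRightCont

variable {Y Z : ℝ → ℝ}

lemma monotoneOn_runSSup (hZ : LocBddRightCont Z) : MonotoneOn (runSSup Z) (Set.Ici 0) :=
  fun _ hs _ _ hst => runSSup_le hs fun _ hu => hZ.le_runSSup ⟨hu.1, hu.2.trans hst⟩

lemma runningSup (hZ : LocBddRightCont Z) : LocBddRightCont (runSSup Z) where
  bdd t := by
    obtain ⟨M, hM⟩ := hZ.bdd t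
    refine ⟨M, fun s hs => abs_le.2 ⟨?_, ?_⟩⟩
    · exact (neg_le_of_abs_le (hM s hs)).trans (hZ.le_runSSup ⟨hs.1, le_rfl⟩)
    · exact runSSup_le hs.1 fun u hu =>
        (le_abs_self _).trans (hM u ⟨hu.1, hu.2.trans hs.2⟩)
  rightCont t ht := by
    rw [Metric.continuousWithinAt_iff]
    intro ε hε
    obtain ⟨δ, hδ, h⟩ := Metric.continuousWithinAt_iff.1 (hZ.rightCont t ht) (ε / 2) (half_pos hε)
    refine ⟨δ, hδ, fun {s} hts hs => ?_⟩
    have hts' : t ≤ s := hts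
    have hle : runSSup Z t ≤ runSSup Z s :=
      hZ.monotoneOn_runSSup ht (ht.trans hts') hts'
    have hge : runSSup Z s ≤ runSSup Z t + ε / 2 := by
      refine runSSup_le (ht.trans hts') fun u hu => ?_
      rcases le_total u t with hut | htu
      · exact (hZ.le_runSSup ⟨hu.1, hut⟩).trans (by linarith)
      · have hud : dist u t < δ := by
          rw [Real.dist_eq, abs_lt] at hs ⊢
          constructor <;> linarith [hu.2]
        have hZu := h (x := u) htu hud
        rw [Real.dist_eq, abs_lt] at hZu
        linarith [hZ.le_runSSup (s := t) ⟨ht, le_rfl⟩]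
    rw [Real.dist_eq, abs_lt]
    constructor <;> linarith

lemma abs_runSSup_sub_le (hY : LocBddRightCont Y) (hZ : LocBddRightCont Z) {t M : ℝ} (ht : 0 ≤ t)
    (h : ∀ s ∈ Set.Icc 0 t, |Y s - Z s| ≤ M) :
    |runSSup Y t - runSSup Z t| ≤ M := by
  rw [abs_sub_le_iff, sub_le_iff_le_add, sub_le_iff_le_add]
  constructor <;> refine runSSup_le ht fun s hs => ?_
  · linarith [(abs_sub_le_iff.1 (h s hs)).1, hZ.le_runSSup hs]
  · linarith [(abs_sub_le_iff.1 (h s hs)).2, hY.le_runSSup hs]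

end LocBddRightCont

lemma Psi_eq_max_runSSup (Y : ℝ → ℝ) (t : ℝ) : Psi Y t = max 0 (runSSup (fun s => -Y s) t) := by
  rw [Psi, runSSup, ← Real.sSup_neg, ← Set.image_neg_eq_neg, Set.image_image]

namespace LocBddRightCont

variable {X K L Y Z : ℝ → ℝ}

lemma monotoneOn_Psi (hY : LocBddRightCont Y) : MonotoneOn (Psi Y) (Set.Ici 0) := by
  intro s hs t ht hst
  simp only [Psi_eq_max_runSSup]
  exact max_le_max le_rfl (hY.neg.monotoneOn_runSSup hs ht hst)

lemma psi (hY : LocBddRightCont Y) : LocBddRightCont (Psi Y) where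
  bdd t := by
    obtain ⟨M, hM⟩ := hY.neg.runningSup.bdd t
    refine ⟨M, fun s hs => ?_⟩
    rw [Psi_eq_max_runSSup, abs_of_nonneg (le_max_left _ _)]
    exact max_le ((abs_nonneg _).trans (hM s hs)) ((le_abs_self _).trans (hM s hs))
  rightCont t ht := by
    rw [funext (Psi_eq_max_runSSup Y)]
    exact continuousWithinAt_const.max (hY.neg.runningSup.rightCont t ht)

lemma abs_Psi_sub_le (hY : LocBddRightCont Y) (hZ : LocBddRightCont Z) {t M : ℝ} (ht : 0 ≤ t)
    (h : ∀ s ∈ Set.Icc 0 t, |Y s - Z s| ≤ M) : |Psi Y t - Psi Z t| ≤ M := by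
  rw [Psi_eq_max_runSSup, Psi_eq_max_runSSup]
  refine (abs_max_sub_max_le_max _ _ _ _).trans (max_le ?_ ?_)
  · rw [sub_self, abs_zero]
    exact (abs_nonneg _).trans (h 0 ⟨le_rfl, ht⟩)
  · refine hY.neg.abs_runSSup_sub_le hZ.neg ht fun s hs => ?_
    rw [← abs_neg]
    convert h s hs using 2
    ring

lemma sub_mul_runSSup (hX : LocBddRightCont X) (hK : LocBddRightCont K) (γ : ℝ) :
    LocBddRightCont fun s => X s - γ * runSSup (fun u => X u + K u) s :=
  hX.sub ((hX.add hK).runningSup.const_mul γ)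

/-- The map `K ↦ Ψ(X − γ S(X+K))` is a `γ`-contraction in the uniform norm on `[0, t]`. -/
lemma abs_Psi_sub_mul_runSSup_sub_le (hX : LocBddRightCont X) (hK : LocBddRightCont K)
    (hL : LocBddRightCont L) {γ t M : ℝ} (hγ : 0 ≤ γ) (ht : 0 ≤ t)
    (h : ∀ s ∈ Set.Icc 0 t, |K s - L s| ≤ M) :
    |Psi (fun s => X s - γ * runSSup (fun u => X u + K u) s) t -
      Psi (fun s => X s - γ * runSSup (fun u => X u + L u) s) t| ≤ γ * M := by
  refine (hX.sub_mul_runSSup hK γ).abs_Psi_sub_le (hX.sub_mul_runSSup hL γ) ht fun s hs => ?_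
  have hS := (hX.add hK).abs_runSSup_sub_le (hX.add hL) hs.1 (M := M) fun u hu => by
    rw [add_sub_add_left_eq_sub]
    exact h u ⟨hu.1, hu.2.trans hs.2⟩
  rw [sub_sub_sub_cancel_left, ← mul_sub, abs_mul, abs_of_nonneg hγ, abs_sub_comm]
  exact mul_le_mul_of_nonneg_left hS hγ

lemma of_geometric_approx {f : ℕ → ℝ → ℝ} (hf : ∀ n, LocBddRightCont (f n)) {γ : ℝ}
    (hγ : 0 ≤ γ) (hγ1 : γ < 1)
    (h : ∀ T : ℝ, ∃ C : ℝ, ∀ n, ∀ s ∈ Set.Icc 0 T, |f n s - K s| ≤ C * γ ^ n) :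
    LocBddRightCont K where
  bdd t := by
    obtain ⟨C, hC⟩ := h t
    obtain ⟨M, hM⟩ := (hf 0).bdd t
    refine ⟨M + C, fun s hs => ?_⟩
    have h0 := hC 0 s hs
    have hM0 := hM s hs
    rw [pow_zero, mul_one] at h0
    rw [abs_le] at *
    constructor <;> linarith
  rightCont t ht := by
    obtain ⟨C, hC⟩ := h (t + 1)
    refine continuousWithinAt_of_locally_uniform_approx_of_continuousWithinAt
      Set.self_mem_Ici fun u hu => ?_
    obtain ⟨ε, hε, hεu⟩ := Metric.mem_uniformity_dist.1 hu
    have hlim : Tendsto (fun n => C * γ ^ n) atTop (nhds 0) := by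
      simpa using (tendsto_pow_atTop_nhds_zero_of_lt_one hγ hγ1).const_mul C
    obtain ⟨n, hn⟩ := (hlim.eventually (gt_mem_nhds hε)).exists
    refine ⟨Set.Icc t (t + 1), Icc_mem_nhdsGE (lt_add_one t), f n, (hf n).rightCont t ht,
      fun y hy => hεu ?_⟩
    rw [dist_comm, Real.dist_eq]
    exact (hC n y ⟨ht.trans hy.1, hy.2⟩).trans_lt hn

lemma cadlag_of_monotoneOn (hK : LocBddRightCont K) (hmono : MonotoneOn K (Set.Ici 0)) :
    Cadlag K := by
  refine ⟨hK.rightCont, fun t ht => ?_⟩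
  obtain ⟨M, hM⟩ := hK.bdd t
  refine ⟨_, (hmono.mono fun s hs => hs.1.le).tendsto_nhdsWithin_Ioo_left
    (nonempty_Ioo.2 ht) ⟨M, ?_⟩⟩
  rintro _ ⟨u, hu, rfl⟩
  exact (le_abs_self _).trans (hM u ⟨hu.1.le, hu.2.le⟩)

end LocBddRightCont

/-- **Unique solvability of the fixed-point equation `K = Ψ(X − γ S(X+K))` on `[0,∞)`.** -/
theorem fixed_point_equation_exists_unique
    (γ : ℝ) (hγ : γ ∈ Set.Ico (0:ℝ) 1)
    (X : ℝ → ℝ) (hX : Cadlag X) (hX0 : X 0 ≤ 0) :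
    (∃ K : ℝ → ℝ, Cadlag K ∧ ∀ t : ℝ, 0 ≤ t →
      K t = Psi (fun s => X s - γ * runSSup (fun u => X u + K u) s) t) ∧
    ∀ K L : ℝ → ℝ, Cadlag K → Cadlag L →
      (∀ t : ℝ, 0 ≤ t →
        K t = Psi (fun s => X s - γ * runSSup (fun u => X u + K u) s) t) →
      (∀ t : ℝ, 0 ≤ t →
        L t = Psi (fun s => X s - γ * runSSup (fun u => X u + L u) s) t) →
      ∀ t : ℝ, 0 ≤ t → K t = L t := by
  obtain ⟨hγ0, hγ1⟩ := hγ
  have hXb := hX.locBddRightCont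
  constructor
  · let G : (ℝ → ℝ) → ℝ → ℝ :=
      fun K => Psi (fun s => X s - γ * runSSup (fun u => X u + K u) s)
    let f : ℕ → ℝ → ℝ := fun n => G^[n] fun _ => 0
    have hsucc : ∀ n, f (n + 1) = G (f n) := fun n => iterate_succ_apply' _ _ _
    have hfb : ∀ n, LocBddRightCont (f n) := by
      intro n
      induction n with
      | zero => exact LocBddRightCont.zero
      | succ n ih => rw [hsucc]; exact (hXb.sub_mul_runSSup ih γ).psi
    have hstep : ∀ T : ℝ, ∃ C : ℝ, ∀ n, ∀ s ∈ Set.Icc 0 T,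
        dist (f n s) (f (n + 1) s) ≤ C * γ ^ n := by
      intro T
      obtain ⟨C, hC⟩ := ((hfb 0).sub (hfb 1)).bdd T
      refine ⟨C, fun n => ?_⟩
      induction n with
      | zero => simpa [Real.dist_eq] using hC
      | succ n ih =>
        intro s hs
        rw [hsucc n, hsucc (n + 1), Real.dist_eq, pow_succ', mul_left_comm]
        exact hXb.abs_Psi_sub_mul_runSSup_sub_le (hfb n) (hfb (n + 1)) hγ0 hs.1
          fun u hu => ih u ⟨hu.1, hu.2.trans hs.2⟩
    have hlim : ∀ t : ℝ, ∃ l : ℝ, 0 ≤ t → Tendsto (fun n => f n t) atTop (nhds l) := by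
      intro t
      by_cases ht : 0 ≤ t
      · obtain ⟨C, hC⟩ := hstep t
        obtain ⟨l, hl⟩ := cauchySeq_tendsto_of_complete
          (cauchySeq_of_le_geometric γ C hγ1 fun n => hC n t ⟨ht, le_rfl⟩)
        exact ⟨l, fun _ => hl⟩
      · exact ⟨0, fun h => absurd h ht⟩
    choose K hK using hlim
    have happrox : ∀ T : ℝ, ∃ C : ℝ, ∀ n, ∀ s ∈ Set.Icc 0 T, |f n s - K s| ≤ C * γ ^ n := by
      intro T
      obtain ⟨C, hC⟩ := hstep T
      refine ⟨C / (1 - γ), fun n s hs => ?_⟩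
      rw [div_mul_eq_mul_div]
      exact dist_le_of_le_geometric_of_tendsto γ C hγ1 (fun n => hC n s hs) (hK s hs.1) n
    have hKb : LocBddRightCont K := .of_geometric_approx hfb hγ0 hγ1 happrox
    have hfix : ∀ t : ℝ, 0 ≤ t → K t = G K t := by
      intro t ht
      obtain ⟨C, hC⟩ := happrox t
      refine tendsto_nhds_unique ((hK t ht).comp (tendsto_add_atTop_nat 1)) ?_
      rw [tendsto_iff_dist_tendsto_zero]
      refine squeeze_zero (g := fun n => γ * (C * γ ^ n)) (fun _ => dist_nonneg) (fun n => ?_) ?_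
      · simp only [comp_apply, hsucc, Real.dist_eq]
        exact hXb.abs_Psi_sub_mul_runSSup_sub_le (hfb n) hKb hγ0 ht (hC n)
      · simpa using ((tendsto_pow_atTop_nhds_zero_of_lt_one hγ0 hγ1).const_mul C).const_mul γ
    refine ⟨K, hKb.cadlag_of_monotoneOn ?_, hfix⟩
    exact (hXb.sub_mul_runSSup hKb γ).monotoneOn_Psi.congr fun t ht => (hfix t ht).symm
  · intro K L hK hL hKfix hLfix t ht
    have hKb := hK.locBddRightCont
    have hLb := hL.locBddRightCont
    obtain ⟨C, hC⟩ := (hKb.sub hLb).bdd t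
    have hpow : ∀ n : ℕ, ∀ s ∈ Set.Icc 0 t, |K s - L s| ≤ C * γ ^ n := by
      intro n
      induction n with
      | zero => simpa using hC
      | succ n ih =>
        intro s hs
        rw [hKfix s hs.1, hLfix s hs.1, pow_succ', mul_left_comm]
        exact hXb.abs_Psi_sub_mul_runSSup_sub_le hKb hLb hγ0 hs.1
          fun u hu => ih u ⟨hu.1, hu.2.trans hs.2⟩
    have hzero : Tendsto (fun n : ℕ => C * γ ^ n) atTop (nhds 0) := by
      simpa using (tendsto_pow_atTop_nhds_zero_of_lt_one hγ0 hγ1).const_mul C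
    have := ge_of_tendsto' hzero fun n => hpow n t ⟨ht, le_rfl⟩
    exact sub_eq_zero.1 (abs_nonpos_iff.1 this)

end
end

section
/- Let x̄ ≥ 0 and let Y : [0,∞) → ℝ be a measurable path with Y_0 ≤ x̄ such that its running supremum Ȳ_t = max(x̄, sup_{0≤s≤t} Y_s) is finite-valued and continuous in t. Let β ∈ [0,1) and let H : [0,∞) → ℝ be measurable with 0 ≤ H_s ≤ β for all s, and define U_t = Y_t − ∫_{(0,t]} H_s dȲ_s and Ū_t = max(x̄, sup_{0≤s≤t} U_s). Then Ū_t ≥ (1−β)·Ȳ_t for all t ≥ 0. -/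
open MeasureTheory Set Filter Function

noncomputable section

theorem le_runSSup {Z : ℝ → ℝ} {s t : ℝ} (hZ : BddAbove (Z '' Set.Icc 0 t))
    (hs : s ∈ Set.Icc 0 t) : Z s ≤ runSSup Z t :=
  le_csSup hZ (mem_image_of_mem Z hs)

theorem runSup_zero {xbar : ℝ} {Z : ℝ → ℝ} (hZ : Z 0 ≤ xbar) : runSup xbar Z 0 = xbar := by
  simp [runSup, runSSup, hZ]

theorem runSup_monotoneOn_s9 (xbar : ℝ) {Z : ℝ → ℝ}
    (hZ : ∀ t : ℝ, 0 ≤ t → BddAbove (Z '' Set.Icc 0 t)) :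
    MonotoneOn (runSup xbar Z) (Set.Ici 0) := by
  intro s hs t ht hst
  have hs' : (0 : ℝ) ≤ s := hs
  exact max_le_max le_rfl (csSup_le_csSup (hZ t ht) ((nonempty_Icc.2 hs').image Z)
    (image_mono (Icc_subset_Icc_right hst)))

theorem lsMeasure_Ioc_zero {f : ℝ → ℝ} (hmono : MonotoneOn f (Set.Ici 0))
    (hcont : ContinuousOn f (Set.Ici 0)) {t : ℝ} (ht : 0 ≤ t) :
    lsMeasure f (Set.Ioc 0 t) = ENNReal.ofReal (f t - f 0) := by
  have h : Monotone (fun t => f (max t 0)) ∧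
      ∀ x : ℝ, ContinuousWithinAt (fun t => f (max t 0)) (Set.Ici x) x := by
    refine ⟨fun s t hst => hmono (le_max_right s 0) (le_max_right t 0)
      (max_le_max hst le_rfl), fun x => ?_⟩
    have hc : Continuous (fun t => f (max t 0)) :=
      hcont.comp_continuous (by fun_prop) fun s => le_max_right s 0
    exact hc.continuousWithinAt
  simp [lsMeasure, lsMeasureAux, dif_pos h, StieltjesFunction.measure_Ioc, ht]

theorem setIntegral_lsMeasure_le {f : ℝ → ℝ} (hmono : MonotoneOn f (Set.Ici 0))
    (hcont : ContinuousOn f (Set.Ici 0)) {H : ℝ → ℝ} {β : ℝ}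
    (hH : ∀ s : ℝ, H s ∈ Set.Icc (0:ℝ) β) {t : ℝ} (ht : 0 ≤ t) :
    ∫ s in Set.Ioc (0:ℝ) t, H s ∂(lsMeasure f) ≤ β * (f t - f 0) := by
  have hμ := lsMeasure_Ioc_zero hmono hcont ht
  have hle := norm_setIntegral_le_of_norm_le_const (μ := lsMeasure f) (f := H)
    (s := Set.Ioc 0 t) (C := β) (by rw [hμ]; exact ENNReal.ofReal_lt_top)
    (fun s _ => by rw [Real.norm_of_nonneg (hH s).1]; exact (hH s).2)
  have hf : 0 ≤ f t - f 0 := sub_nonneg.2 (hmono self_mem_Ici ht ht)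
  rw [measureReal_def, hμ, ENNReal.toReal_ofReal hf] at hle
  exact (le_abs_self _).trans hle

/-- **Lower bound for the running supremum of the taxed process.** -/
theorem running_sup_taxed_lower_bound
    (xbar : ℝ) (hxbar : 0 ≤ xbar)
    (Y : ℝ → ℝ) (hYmeas : Measurable Y) (hY0 : Y 0 ≤ xbar)
    (hYbdd : ∀ t : ℝ, 0 ≤ t → BddAbove (Y '' Set.Icc 0 t))
    (hcont : ContinuousOn (runSup xbar Y) (Set.Ici 0))
    (β : ℝ) (hβ : β ∈ Set.Ico (0:ℝ) 1)
    (H : ℝ → ℝ) (hHmeas : Measurable H)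
    (hH : ∀ s : ℝ, H s ∈ Set.Icc (0:ℝ) β)
    (U : ℝ → ℝ)
    (hU : ∀ t : ℝ, U t = Y t - ∫ s in Set.Ioc (0:ℝ) t, H s ∂(lsMeasure (runSup xbar Y))) :
    ∀ t : ℝ, 0 ≤ t → (1 - β) * runSup xbar Y t ≤ runSup xbar U t := by
  intro t ht
  have hmono := runSup_monotoneOn_s9 xbar hYbdd
  have hUle (s : ℝ) : U s ≤ Y s := by
    rw [hU]
    exact sub_le_self _ (integral_nonneg fun r => (hH r).1)
  have hUbdd : BddAbove (U '' Set.Icc 0 t) := by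
    obtain ⟨b, hb⟩ := hYbdd t ht
    refine ⟨b, ?_⟩
    rintro _ ⟨s, hs, rfl⟩
    exact (hUle s).trans (hb (mem_image_of_mem Y hs))
  have hsup : runSSup Y t ≤ runSup xbar U t + β * (runSup xbar Y t - xbar) := by
    refine csSup_le ((nonempty_Icc.2 ht).image Y) ?_
    rintro _ ⟨s, hs, rfl⟩
    have hint := setIntegral_lsMeasure_le hmono hcont hH hs.1
    rw [runSup_zero hY0] at hint
    have hβmono := mul_le_mul_of_nonneg_left (hmono hs.1 ht hs.2) hβ.1
    have hUs : U s ≤ runSup xbar U t := (le_runSSup hUbdd hs).trans (le_max_right _ _)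
    rw [hU s] at hUs
    linarith
  have hxU : xbar ≤ runSup xbar U t := le_max_left _ _
  have hβx := mul_nonneg hβ.1 hxbar
  have hxY : xbar ≤ runSup xbar Y t := le_max_left _ _
  have hβY := mul_le_mul_of_nonneg_left hxY hβ.1
  have hYle : runSup xbar Y t ≤ runSup xbar U t + β * (runSup xbar Y t - xbar) :=
    max_le (by linarith) hsup
  linarith

end
end
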